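/- arXiv:1707.01016 — 2 statements merged into one kernel-verified Lean document; each statement's English description precedes it below -/
import Mathlib

section
/- There exist finite graphs G and H such that G ≅_qa H but G is not ≅_q H. -/
open Matrix

noncomputable section

/-- The set of quantum correlations with input set `I` and output set `O`:
`p x y a b` is the probability of outputs `(a,b)` on inputs `(x,y)`, realised by
finite-dimensional PVMs `E`, `F` and a unit vector `ψ` in the tensor product
(Kronecker) Hilbert space. -/
def QCorr (I O : Type) [Fintype I] [Fintype O] : Set (I → I → O → O → ℝ) :=
  {p | ∃ dA dB : ℕ, 0 < dA ∧ 0 < dB ∧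
    ∃ (E : I → O → Matrix (Fin dA) (Fin dA) ℂ)
      (F : I → O → Matrix (Fin dB) (Fin dB) ℂ)
      (ψ : Fin dA × Fin dB → ℂ),
      (∀ x a, (E x a).IsHermitian ∧ E x a * E x a = E x a) ∧
      (∀ x, ∑ a, E x a = 1) ∧
      (∀ y b, (F y b).IsHermitian ∧ F y b * F y b = F y b) ∧
      (∀ y, ∑ b, F y b = 1) ∧
      star ψ ⬝ᵥ ψ = 1 ∧
      (∀ x y a b, (p x y a b : ℂ) =
        star ψ ⬝ᵥ (Matrix.kroneckerMap (· * ·) (E x a) (F y b)).mulVec ψ) }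

/-- A game (described by its losing-tuple predicate `lose`: `lose x y a b` means
`λ(x,y,a,b) = 0`) has a perfect q-strategy. -/
def PerfectQ {I O : Type} [Fintype I] [Fintype O]
    (lose : I → I → O → O → Prop) : Prop :=
  ∃ p ∈ QCorr I O, ∀ x y a b, lose x y a b → p x y a b = 0

/-- A game has a perfect qa-strategy: a correlation in the closure of `QCorr`
vanishing on losing tuples. -/
def PerfectQA {I O : Type} [Fintype I] [Fintype O]
    (lose : I → I → O → O → Prop) : Prop :=
  ∃ p ∈ closure (QCorr I O), ∀ x y a b, lose x y a b → p x y a b = 0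

/-- The losing tuples of the independence game for a graph `G` with `c` inputs:
on inputs `(i,j)` and outputs `(v,w)`, the players lose iff (`i = j` and `v ≠ w`) or
(`i ≠ j` and (`v = w` or `v ∼ w`)). -/
def indepLose {V : Type} (G : SimpleGraph V) (c : ℕ) :
    Fin c → Fin c → V → V → Prop :=
  fun i j v w => (i = j ∧ v ≠ w) ∨ (i ≠ j ∧ (v = w ∨ G.Adj v w))

/-- The quantum independence number `α_q(G)`: the largest `c` for which the
independence game has a perfect q-strategy. -/
def alphaQ {V : Type} [Fintype V] (G : SimpleGraph V) : ℕ :=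
  sSup {c : ℕ | PerfectQ (indepLose G c)}

/-- The quantum approximate independence number `α_qa(G)`. -/
def alphaQA {V : Type} [Fintype V] (G : SimpleGraph V) : ℕ :=
  sSup {c : ℕ | PerfectQA (indepLose G c)}

/-- The losing tuples of the `d`-coloring game for a graph `G`. -/
def colorLose {V : Type} (G : SimpleGraph V) (d : ℕ) :
    V → V → Fin d → Fin d → Prop :=
  fun v w i j => (v = w ∧ i ≠ j) ∨ (G.Adj v w ∧ i = j)

/-- The quantum chromatic number `χ_q(G)`: the least `d` for which the `d`-coloring
game has a perfect q-strategy. -/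
def chiQ {V : Type} [Fintype V] (G : SimpleGraph V) : ℕ :=
  sInf {d : ℕ | PerfectQ (colorLose G d)}

/-- The quantum approximate chromatic number `χ_qa(G)`. -/
def chiQA {V : Type} [Fintype V] (G : SimpleGraph V) : ℕ :=
  sInf {d : ℕ | PerfectQA (colorLose G d)}

/-- `rel(g,g') = rel(h,h')` for vertices `g, g'` of `G` and `h, h'` of `H`. -/
def relSame {VG VH : Type} (G : SimpleGraph VG) (H : SimpleGraph VH)
    (g g' : VG) (h h' : VH) : Prop :=
  (g = g' ∧ h = h') ∨ (G.Adj g g' ∧ H.Adj h h') ∨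
    (g ≠ g' ∧ ¬ G.Adj g g' ∧ h ≠ h' ∧ ¬ H.Adj h h')

/-- Pair an input and an output of the `(G,H)`-isomorphism game into an element of
`V(G) × V(H)`, provided the output lies in the opposite graph from the input
(otherwise `none`). -/
def pairIO {VG VH : Type} : (VG ⊕ VH) → (VG ⊕ VH) → Option (VG × VH)
  | Sum.inl g, Sum.inr h => some (g, h)
  | Sum.inr h, Sum.inl g => some (g, h)
  | _, _ => none

/-- The losing tuples of the `(G,H)`-isomorphism game: the players win iff each
output is in the opposite graph from the corresponding input and, for the resulting
pairs `(g_A, h_A)`, `(g_B, h_B)`, one has `rel(g_A,g_B) = rel(h_A,h_B)`. -/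
def isoLose {VG VH : Type} (G : SimpleGraph VG) (H : SimpleGraph VH) :
    (VG ⊕ VH) → (VG ⊕ VH) → (VG ⊕ VH) → (VG ⊕ VH) → Prop :=
  fun xA xB aA aB =>
    ¬ ∃ (gA : VG) (hA : VH) (gB : VG) (hB : VH),
        pairIO xA aA = some (gA, hA) ∧ pairIO xB aB = some (gB, hB) ∧
        relSame G H gA gB hA hB

/-- `G ≅_q H`: the `(G,H)`-isomorphism game has a perfect q-strategy. -/
def QIso {VG VH : Type} [Fintype VG] [Fintype VH]
    (G : SimpleGraph VG) (H : SimpleGraph VH) : Prop :=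
  PerfectQ (isoLose G H)

/-- `G ≅_qa H`: the `(G,H)`-isomorphism game has a perfect qa-strategy. -/
def QAIso {VG VH : Type} [Fintype VG] [Fintype VH]
    (G : SimpleGraph VG) (H : SimpleGraph VH) : Prop :=
  PerfectQA (isoLose G H)



/-! ### Part A: from a perfect q-strategy to an operator solution -/

/-- On a nonzero finite dimensional space, idempotents satisfying the game relations. -/
theorem ops_of_perfectQ {I O : Type} [Fintype I] [Fintype O] [DecidableEq O]
    (lose : I → I → O → O → Prop) (hsync : ∀ x a b, a ≠ b → lose x x a b)
    (h : PerfectQ lose) :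
    ∃ (d : ℕ) (R : Submodule ℂ (Fin d → ℂ)), Nontrivial R ∧
      ∃ e : I → O → Module.End ℂ R, (∀ x a, e x a * e x a = e x a) ∧
        (∀ x, ∑ a, e x a = 1) ∧
        (∀ x y a b, lose x y a b → e x a * e y b = 0) := by
  obtain ⟨p, ⟨dA, dB, hdA, hdB, E, F, ψ, hE, hE1, hF, hF1, hψ, hp⟩, hl⟩ := h
  set K : Matrix (Fin dA) (Fin dB) ℂ := Matrix.of fun i j => ψ (i, j) with hK
  have key : ∀ x y a b, lose x y a b → E x a * K * (F y b)ᵀ = 0 := by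
    intro x y a b hlose
    have h0 := hp x y a b
    rw [hl x y a b hlose] at h0
    have hval : star ψ ⬝ᵥ (Matrix.kroneckerMap (· * ·) (E x a) (F y b)).mulVec ψ
        = (Kᴴ * (E x a * K * (F y b)ᵀ)).trace := by
      simp only [Matrix.trace, Matrix.diag, Matrix.mul_apply, Matrix.mulVec, dotProduct,
        Matrix.kroneckerMap_apply, Matrix.conjTranspose_apply, Matrix.transpose_apply,
        Fintype.sum_prod_type, Pi.star_apply, hK, Matrix.of_apply]
      rw [Finset.sum_comm]
      refine Finset.sum_congr rfl fun j _ => Finset.sum_congr rfl fun i _ => ?_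
      congr 1
      rw [Finset.sum_comm]
      refine Finset.sum_congr rfl fun j' _ => ?_
      rw [Finset.sum_mul]
      refine Finset.sum_congr rfl fun i' _ => ?_
      ring
    have hFt : ((F y b)ᵀ)ᴴ = (F y b)ᵀ := by
      ext i j
      have := congrFun (congrFun (hF y b).1.eq j) i
      simpa [Matrix.conjTranspose_apply] using this
    have h2 : ((E x a * K * (F y b)ᵀ)ᴴ * (E x a * K * (F y b)ᵀ)).trace = 0 := by
      have : ((E x a * K * (F y b)ᵀ)ᴴ * (E x a * K * (F y b)ᵀ))
          = (F y b)ᵀ * (Kᴴ * (E x a * K * (F y b)ᵀ)) := by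
        rw [Matrix.conjTranspose_mul, Matrix.conjTranspose_mul, hFt, (hE x a).1.eq]
        simp only [Matrix.mul_assoc]
        rw [← Matrix.mul_assoc (E x a) (E x a), (hE x a).2]
      rw [this, Matrix.trace_mul_comm]
      have : Kᴴ * (E x a * K * (F y b)ᵀ) * (F y b)ᵀ = Kᴴ * (E x a * K * (F y b)ᵀ) := by
        simp only [Matrix.mul_assoc]
        rw [← Matrix.transpose_mul, (hF y b).2]
      rw [this, ← hval, ← h0]; simp
    open scoped ComplexOrder in
    exact Matrix.trace_conjTranspose_mul_self_eq_zero_iff.1 h2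
  have inter : ∀ x a, E x a * K = K * (F x a)ᵀ := by
    intro x a
    have h1 : E x a * K = E x a * K * (F x a)ᵀ := by
      have : E x a * K = E x a * K * (∑ b, F x b)ᵀ := by rw [hF1]; simp
      rw [Matrix.transpose_sum, Matrix.mul_sum] at this
      refine this.trans (Finset.sum_eq_single a ?_ ?_)
      · intro b _ hb; exact key x x a b (hsync x a b hb.symm)
      · simp
    have h2 : K * (F x a)ᵀ = E x a * K * (F x a)ᵀ := by
      have : K * (F x a)ᵀ = (∑ b, E x b) * K * (F x a)ᵀ := by rw [hE1]; simp
      rw [Matrix.sum_mul, Matrix.sum_mul] at this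
      refine this.trans (Finset.sum_eq_single a ?_ ?_)
      · intro b _ hb; exact key x x b a (hsync x b a hb)
      · simp
    rw [h1, h2]
  have hmap : ∀ x a, ∀ w ∈ LinearMap.range K.mulVecLin, (E x a).mulVecLin w ∈
      LinearMap.range K.mulVecLin := by
    rintro x a _ ⟨w, rfl⟩
    refine ⟨(F x a)ᵀ.mulVec w, ?_⟩
    simp only [Matrix.mulVecLin_apply, Matrix.mulVec_mulVec, inter]
  refine ⟨dA, LinearMap.range K.mulVecLin, ?_,
    fun x a => (E x a).mulVecLin.restrict (hmap x a), ?_, ?_, ?_⟩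
  · rw [Submodule.nontrivial_iff_ne_bot]
    intro h0
    rw [LinearMap.range_eq_bot] at h0
    have hK0 : K = 0 := by
      ext i j
      have := congrFun (LinearMap.congr_fun h0 (Pi.single j 1)) i
      simpa using this
    have : ψ = 0 := by
      ext ⟨i, j⟩
      exact congrFun (congrFun hK0 i) j
    rw [this] at hψ
    simp at hψ
  · intro x a
    ext1 w
    apply Subtype.ext
    simp [Matrix.mulVec_mulVec, (hE x a).2]
  · intro x
    ext1 w
    apply Subtype.ext
    simp only [LinearMap.sum_apply, Submodule.coe_sum, LinearMap.coe_restrict_apply,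
      Matrix.mulVecLin_apply, Module.End.one_apply]
    rw [← Matrix.sum_mulVec, hE1, Matrix.one_mulVec]
  · intro x y a b hlose
    ext1 w
    apply Subtype.ext
    obtain ⟨_, w, rfl⟩ := w
    simp only [Module.End.mul_apply, LinearMap.coe_restrict_apply, Matrix.mulVecLin_apply,
      Matrix.mulVec_mulVec, LinearMap.zero_apply, Submodule.coe_zero]
    rw [inter y b, ← Matrix.mul_assoc, key x y a b hlose, Matrix.zero_mulVec]

/-- Idempotents whose sum is `m` times the identity are all the identity. -/
theorem idem_eq_one {R : Type} [AddCommGroup R] [Module ℂ R] [FiniteDimensional ℂ R]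
    {κ : Type} [Fintype κ] (Q : κ → Module.End ℂ R) (hQ : ∀ k, Q k * Q k = Q k)
    (hs : ∑ k, Q k = (Fintype.card κ : Module.End ℂ R)) (k : κ) : Q k = 1 := by
  have hproj : ∀ k, LinearMap.IsProj (LinearMap.range (Q k)) (Q k) := fun k =>
    LinearMap.IsIdempotentElem.isProj_range _ (hQ k)
  have htr : ∀ k, LinearMap.trace ℂ R (Q k) = Module.finrank ℂ (LinearMap.range (Q k)) :=
    fun k => (hproj k).trace
  have h1 := congrArg (LinearMap.trace ℂ R) hs
  rw [map_sum] at h1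
  simp only [htr] at h1
  have h2 : LinearMap.trace ℂ R (Fintype.card κ : Module.End ℂ R)
      = (Fintype.card κ * Module.finrank ℂ R : ℕ) := by
    rw [← nsmul_one, map_nsmul, LinearMap.trace_one]; simp
  rw [h2] at h1
  have h3 : ∑ k, Module.finrank ℂ (LinearMap.range (Q k)) = ∑ k : κ, Module.finrank ℂ R := by
    simp only [Finset.sum_const, Finset.card_univ, smul_eq_mul]
    exact_mod_cast h1
  have h4 := (Finset.sum_eq_sum_iff_of_le
    (fun k _ => Submodule.finrank_le (LinearMap.range (Q k)))).1 h3 k (Finset.mem_univ _)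
  have h5 := Submodule.eq_top_of_finrank_eq h4
  ext w
  have : w ∈ LinearMap.range (Q k) := by rw [h5]; trivial
  exact (hproj k).map_id w this


/-! ### Linear system graphs -/

/-- Vertices of the graph of a linear system: an equation with a satisfying assignment. -/
abbrev SV {Eqn : Type} (b : Eqn → ℤˣ) : Type :=
  Σ k : Eqn, {α : Fin 3 → ℤˣ // α 0 * α 1 * α 2 = b k}

/-- The graph of a linear system: inconsistent vertices are adjacent. -/
def SG {Var Eqn : Type} (s : Eqn → Fin 3 → Var) (hs : ∀ k, Function.Injective (s k))
    (b : Eqn → ℤˣ) : SimpleGraph (SV b) where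
  Adj v w := ∃ i j, s v.1 i = s w.1 j ∧ v.2.1 i ≠ w.2.1 j
  symm := ⟨by
    rintro v w ⟨i, j, h, h'⟩
    exact ⟨j, i, h.symm, h'.symm⟩⟩
  loopless := ⟨by
    rintro v ⟨i, j, h, h'⟩
    rw [hs _ h] at h'
    exact h' rfl⟩

/-- The all-ones vertex of the homogeneous system. -/
def zv {Eqn : Type} (k : Eqn) : SV (fun _ : Eqn => (1 : ℤˣ)) := ⟨k, fun _ => 1, by simp⟩

theorem isoLose_sync {VG VH : Type} (G : SimpleGraph VG) (H : SimpleGraph VH)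
    (x a b : VG ⊕ VH) (hab : a ≠ b) : isoLose G H x x a b := by
  rintro ⟨g, h, g', h', h1, h2, h3⟩
  rcases x with x | x <;> rcases a with a | a <;> rcases b with b | b <;>
    simp_all [pairIO, relSame]

theorem isoLose_inl_inl {VG VH : Type} (G : SimpleGraph VG) (H : SimpleGraph VH)
    (g g' : VG) (y b : VG ⊕ VH) : isoLose G H (Sum.inl g) y (Sum.inl g') b := by
  rintro ⟨g, h, g', h', h1, h2, h3⟩
  simp [pairIO] at h1

theorem isoLose_inl_inr {VG VH : Type} (G : SimpleGraph VG) (H : SimpleGraph VH)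
    (g g' : VG) (h h' : VH) (hr : ¬ relSame G H g g' h h') :
    isoLose G H (Sum.inl g) (Sum.inl g') (Sum.inr h) (Sum.inr h') := by
  rintro ⟨g, h, g', h', h1, h2, h3⟩
  simp [pairIO] at h1 h2
  obtain ⟨rfl, rfl⟩ := h1
  obtain ⟨rfl, rfl⟩ := h2
  exact hr h3

/-- Projection-valued solutions. -/
theorem pvm_of_qiso {Var Eqn : Type} [Fintype Eqn] [DecidableEq Eqn] (s : Eqn → Fin 3 → Var)
    (hs : ∀ k, Function.Injective (s k)) (b : Eqn → ℤˣ)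
    (h : QIso (SG s hs (fun _ => 1)) (SG s hs b)) :
    ∃ (d : ℕ) (R : Submodule ℂ (Fin d → ℂ)), Nontrivial R ∧
      ∃ P : SV b → Module.End ℂ R, (∀ v, P v * P v = P v) ∧
        (∀ k, ∑ α, P ⟨k, α⟩ = 1) ∧
        (∀ v w, (SG s hs b).Adj v w → P v * P w = 0) := by
  classical
  obtain ⟨d, R, hR, e, he, he1, hl⟩ := ops_of_perfectQ _ (isoLose_sync _ _) h
  set G := SG s hs (fun _ => 1) with hG
  set H := SG s hs b with hH
  have h0 : ∀ g g', e (Sum.inl g) (Sum.inl g') = 0 := by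
    intro g g'
    have : e (Sum.inl g) (Sum.inl g') * ∑ b, e (Sum.inl g) b = 0 := by
      rw [Finset.mul_sum]
      exact Finset.sum_eq_zero fun b _ => hl _ _ _ _ (isoLose_inl_inl G H _ _ _ _)
    rwa [he1, mul_one] at this
  have h1 : ∀ g, ∑ v, e (Sum.inl g) (Sum.inr v) = 1 := by
    intro g
    have := he1 (Sum.inl g)
    rw [Fintype.sum_sum_type] at this
    simpa [h0] using this
  have hz : ∀ k l, ¬ G.Adj (zv k) (zv l) := by
    rintro k l ⟨i, j, _, h⟩
    exact h rfl
  have hort : ∀ k l v w, (k ≠ l → v = w ∨ H.Adj v w) → (k = l → v ≠ w) →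
      e (Sum.inl (zv k)) (Sum.inr v) * e (Sum.inl (zv l)) (Sum.inr w) = 0 := by
    intro k l v w hvw hvw'
    apply hl
    apply isoLose_inl_inr
    by_cases hkl : k = l
    · subst hkl
      simp [relSame, hvw' rfl]
    · have : zv k ≠ zv l := fun h => hkl (congrArg Sigma.fst h)
      have h2 := hvw hkl
      simp only [relSame, this, hz, false_and, not_false_eq_true, true_and, false_or]
      tauto
  let P : SV b → Module.End ℂ R := fun v => ∑ k, e (Sum.inl (zv k)) (Sum.inr v)
  have hPidem : ∀ v, P v * P v = P v := by
    intro v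
    simp only [P, Finset.sum_mul, Finset.mul_sum]
    refine Finset.sum_congr rfl fun k _ => ?_
    rw [Finset.sum_eq_single k]
    · exact he _ _
    · intro l _ hlk
      exact hort _ _ _ _ (fun _ => Or.inl rfl) (fun h => absurd h hlk)
    · simp
  have hPadj : ∀ v w, H.Adj v w → P v * P w = 0 := by
    intro v w hvw
    simp only [P, Finset.sum_mul, Finset.mul_sum]
    refine Finset.sum_eq_zero fun k _ => Finset.sum_eq_zero fun l _ => ?_
    exact hort _ _ _ _ (fun _ => Or.inr hvw) (fun _ => hvw.ne)
  have hsame : ∀ k α β, α ≠ β → H.Adj ⟨k, α⟩ ⟨k, β⟩ := by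
    intro k α β hab
    have : ∃ i, α.1 i ≠ β.1 i := by
      by_contra hc
      push Not at hc
      exact hab (Subtype.ext (funext hc))
    obtain ⟨i, hi⟩ := this
    exact ⟨i, i, rfl, hi⟩
  refine ⟨d, R, hR, P, hPidem, ?_, hPadj⟩
  refine idem_eq_one (fun k => ∑ α, P ⟨k, α⟩) ?_ ?_
  · intro k
    simp only [Finset.sum_mul, Finset.mul_sum]
    refine Finset.sum_congr rfl fun α _ => ?_
    rw [Finset.sum_eq_single α]
    · exact hPidem _
    · intro β _ hab
      exact hPadj _ _ (hsame _ _ _ hab)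
    · simp
  · have : ∑ k, ∑ α, P ⟨k, α⟩ = ∑ v : SV b, P v := by
      rw [← Finset.univ_sigma_univ, Finset.sum_sigma]
    rw [this]
    simp only [P]
    rw [Finset.sum_comm]
    simp [h1]

/-- Operator solutions from projection-valued ones. -/
theorem lin_of_pvm {Var Eqn A : Type} [Ring A] (s : Eqn → Fin 3 → Var)
    (hs : ∀ k, Function.Injective (s k)) (b : Eqn → ℤˣ) (P : SV b → A)
    (hP : ∀ v, P v * P v = P v) (hP1 : ∀ k, ∑ α, P ⟨k, α⟩ = 1)
    (hPadj : ∀ v w, (SG s hs b).Adj v w → P v * P w = 0) :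
      ∃ X : Var → A,
        (∀ k i, X (s k i) * X (s k i) = 1) ∧
        (∀ k i j, X (s k i) * X (s k j) = X (s k j) * X (s k i)) ∧
        (∀ k, X (s k 0) * X (s k 1) * X (s k 2) = (((b k : ℤˣ) : ℤ) : A)) := by
  classical
  -- sum of values of a function of the assignment
  let Φ : (k : Eqn) → ((Fin 3 → ℤˣ) → ℤ) → A :=
    fun k f => ∑ α, (f α.1) • P ⟨k, α⟩
  have hort : ∀ k α β, α ≠ β → P ⟨k, α⟩ * P ⟨k, β⟩ = 0 := by
    intro k α β hab
    apply hPadj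
    have : ∃ i, α.1 i ≠ β.1 i := by
      by_contra hc
      push Not at hc
      exact hab (Subtype.ext (funext hc))
    obtain ⟨i, hi⟩ := this
    exact ⟨i, i, rfl, hi⟩
  have hmul : ∀ k f g, Φ k f * Φ k g = Φ k (fun α => f α * g α) := by
    intro k f g
    simp only [Φ, Finset.sum_mul, Finset.mul_sum]
    refine Finset.sum_congr rfl fun α _ => ?_
    rw [Finset.sum_eq_single α]
    · rw [smul_mul_smul_comm, hP]
    · intro β _ hab
      rw [smul_mul_smul_comm, hort _ _ _ hab, smul_zero]
    · simp
  have hconst : ∀ k (c : ℤ) (f : (Fin 3 → ℤˣ) → ℤ), (∀ α : Fin 3 → ℤˣ,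
      α 0 * α 1 * α 2 = b k → f α = c) → Φ k f = (c : A) := by
    intro k c f hf
    have : Φ k f = ∑ α, c • P ⟨k, α⟩ :=
      Finset.sum_congr rfl fun α _ => by rw [hf α.1 α.2]
    rw [this, ← Finset.smul_sum, hP1, zsmul_one]
  have hwd : ∀ k l i j, s k i = s l j →
      Φ k (fun α => (α i : ℤ)) = Φ l (fun α => (α j : ℤ)) := by
    intro k l i j hij
    have e1 : Φ k (fun α => (α i : ℤ)) = ∑ α, ∑ β, (α.1 i : ℤ) • (P ⟨k, α⟩ * P ⟨l, β⟩) := by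
      simp only [Φ]
      refine Finset.sum_congr rfl fun α _ => ?_
      rw [← Finset.smul_sum, ← Finset.mul_sum, hP1, mul_one]
    have e2 : Φ l (fun α => (α j : ℤ)) = ∑ α, ∑ β, (β.1 j : ℤ) • (P ⟨k, α⟩ * P ⟨l, β⟩) := by
      simp only [Φ]
      rw [Finset.sum_comm]
      refine Finset.sum_congr rfl fun β _ => ?_
      rw [← Finset.smul_sum, ← Finset.sum_mul, hP1, one_mul]
    rw [e1, e2]
    refine Finset.sum_congr rfl fun α _ => Finset.sum_congr rfl fun β _ => ?_
    by_cases hab : α.1 i = β.1 j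
    · rw [hab]
    · rw [hPadj ⟨k, α⟩ ⟨l, β⟩ ⟨i, j, hij, hab⟩, smul_zero, smul_zero]
  clear_value Φ
  let X : Var → A := fun v =>
    if h : ∃ p : Eqn × Fin 3, s p.1 p.2 = v then
      Φ h.choose.1 (fun α => (α h.choose.2 : ℤ)) else 1
  have hX : ∀ k i, X (s k i) = Φ k (fun α => (α i : ℤ)) := by
    intro k i
    have hex : ∃ p : Eqn × Fin 3, s p.1 p.2 = s k i := ⟨(k, i), rfl⟩
    simp only [X, dif_pos hex]
    exact hwd _ _ _ _ hex.choose_spec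
  refine ⟨X, ?_, ?_, ?_⟩
  · intro k i
    rw [hX, hmul, hconst k 1, Int.cast_one]
    intro α _
    rw [← Units.val_mul, Int.units_mul_self, Units.val_one]
  · intro k i j
    rw [hX, hX, hmul, hmul]
    congr 1
    funext α
    exact mul_comm _ _
  · intro k
    rw [hX, hX, hX, hmul, hmul, hconst k (b k)]
    intro α hα
    rw [← hα]
    push_cast
    rfl

/-- Operator solutions. -/
theorem lin_of_qiso {Var Eqn : Type} [Fintype Eqn] [DecidableEq Eqn] (s : Eqn → Fin 3 → Var)
    (hs : ∀ k, Function.Injective (s k)) (b : Eqn → ℤˣ)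
    (h : QIso (SG s hs (fun _ => 1)) (SG s hs b)) :
    ∃ (d : ℕ) (R : Submodule ℂ (Fin d → ℂ)), Nontrivial R ∧
      ∃ X : Var → Module.End ℂ R,
        (∀ k i, X (s k i) * X (s k i) = 1) ∧
        (∀ k i j, X (s k i) * X (s k j) = X (s k j) * X (s k i)) ∧
        (∀ k, X (s k 0) * X (s k 1) * X (s k 2) = (((b k : ℤˣ) : ℤ) : Module.End ℂ R)) := by
  classical
  obtain ⟨d, R, hR, P, hP, hP1, hPadj⟩ := pvm_of_qiso s hs b h
  exact ⟨d, R, hR, lin_of_pvm s hs b P hP hP1 hPadj⟩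


/-! ### Part B: from approximate operator solutions to a perfect qa-strategy -/

/-- Correlations of the maximally entangled state. -/
theorem trace_mem_QCorr {I O ι : Type} [Fintype I] [Fintype O] [Fintype ι] [DecidableEq ι]
    [Nonempty ι] (e : I → O → Matrix ι ι ℂ)
    (he : ∀ x a, (e x a).IsHermitian ∧ e x a * e x a = e x a) (he1 : ∀ x, ∑ a, e x a = 1)
    (p : I → I → O → O → ℝ)
    (hp : ∀ x y a b, (p x y a b : ℂ) = (e x a * e y b).trace / (Fintype.card ι : ℂ)) :
    p ∈ QCorr I O := by
  set n := Fintype.card ι with hn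
  have hn0 : 0 < n := Fintype.card_pos
  let φ : ι ≃ Fin n := Fintype.equivFin ι
  let r : Matrix ι ι ℂ ≃ₐ[ℂ] Matrix (Fin n) (Fin n) ℂ := Matrix.reindexAlgEquiv ℂ ℂ φ
  have hr : ∀ M i j, r M i j = M (φ.symm i) (φ.symm j) := fun M i j => rfl
  have hrH : ∀ M : Matrix ι ι ℂ, M.IsHermitian → (r M).IsHermitian := by
    intro M hM
    ext i j
    have := congrFun (congrFun hM.eq (φ.symm i)) (φ.symm j)
    simpa [Matrix.conjTranspose_apply, hr] using this
  set c : ℂ := (((Real.sqrt n)⁻¹ : ℝ) : ℂ) with hc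
  have hcc : star c * c = (n : ℂ)⁻¹ := by
    rw [hc]
    simp only [RCLike.star_def, Complex.conj_ofReal]
    rw [← Complex.ofReal_mul, ← mul_inv, Real.mul_self_sqrt (by positivity)]
    simp
  have hnC : (n : ℂ) ≠ 0 := by exact_mod_cast hn0.ne'
  refine ⟨n, n, hn0, hn0, fun x a => r (e x a), fun x a => (r (e x a))ᵀ,
    fun q => if q.1 = q.2 then c else 0, ?_, ?_, ?_, ?_, ?_, ?_⟩
  · intro x a
    refine ⟨hrH _ (he x a).1, ?_⟩
    rw [← map_mul, (he x a).2]
  · intro x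
    rw [← map_sum, he1, map_one]
  · intro x a
    refine ⟨(hrH _ (he x a).1).transpose, ?_⟩
    rw [← Matrix.transpose_mul, ← map_mul, (he x a).2]
  · intro x
    rw [← Matrix.transpose_sum, ← map_sum, he1, map_one, Matrix.transpose_one]
  · simp only [dotProduct, Fintype.sum_prod_type, Pi.star_apply]
    have : ∀ i j : Fin n, star (if i = j then c else 0) * (if i = j then c else 0)
        = if i = j then (n : ℂ)⁻¹ else 0 := by
      intro i j
      split_ifs
      · exact hcc
      · simp
    simp only [this, Finset.sum_ite_eq, Finset.mem_univ, if_true, Finset.sum_const,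
      Finset.card_univ, Fintype.card_fin, nsmul_eq_mul]
    exact mul_inv_cancel₀ hnC
  · intro x y a b
    rw [hp]
    simp only [dotProduct, Fintype.sum_prod_type, Pi.star_apply, Matrix.mulVec,
      Matrix.kroneckerMap_apply, Matrix.transpose_apply, apply_ite star, star_zero, ite_mul,
      mul_ite, zero_mul, mul_zero, Finset.sum_ite_eq, Finset.mem_univ, if_true]
    have htr : (e x a * e y b).trace = (r (e x a) * r (e y b)).trace := by
      rw [← map_mul]
      simp only [Matrix.trace, Matrix.diag, hr]
      exact (Equiv.sum_comp φ.symm (fun i => (e x a * e y b) i i)).symm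
    rw [htr]
    simp only [Matrix.trace, Matrix.diag, Matrix.mul_apply]
    rw [div_eq_mul_inv, ← hcc, Finset.sum_mul]
    refine Finset.sum_congr rfl fun i _ => ?_
    rw [Finset.sum_mul, Finset.mul_sum]
    refine Finset.sum_congr rfl fun j _ => ?_
    ring

/-- Approximately perfect strategies suffice. -/
theorem perfectQA_of_approx {I O : Type} [Fintype I] [Fintype O]
    (lose : I → I → O → O → Prop)
    (h : ∀ ε : ℝ, 0 < ε → ∃ p ∈ QCorr I O, (∀ x y a b, 0 ≤ p x y a b ∧ p x y a b ≤ 1) ∧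
      ∀ x y a b, lose x y a b → p x y a b ≤ ε) : PerfectQA lose := by
  have h' : ∀ m : ℕ, ∃ p ∈ QCorr I O, (∀ x y a b, 0 ≤ p x y a b ∧ p x y a b ≤ 1) ∧
      ∀ x y a b, lose x y a b → p x y a b ≤ 1 / ((m : ℝ) + 1) := fun m => h _ (by positivity)
  choose p hp hp01 hpl using h'
  have hcomp : IsCompact (Set.Icc (0 : I → I → O → O → ℝ) 1) := isCompact_Icc
  obtain ⟨q, -, f, hf, hlim⟩ := hcomp.tendsto_subseq (x := p)
    (fun m => ⟨fun x y a b => (hp01 m x y a b).1, fun x y a b => (hp01 m x y a b).2⟩)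
  refine ⟨q, mem_closure_of_tendsto hlim (Filter.Eventually.of_forall fun m => hp _), ?_⟩
  intro x y a b hlose
  have hl : Filter.Tendsto (fun m => p (f m) x y a b) Filter.atTop (nhds (q x y a b)) := by
    have h1 := tendsto_pi_nhds.1 hlim x
    have h2 := tendsto_pi_nhds.1 h1 y
    have h3 := tendsto_pi_nhds.1 h2 a
    exact tendsto_pi_nhds.1 h3 b
  have hz : Filter.Tendsto (fun m => p (f m) x y a b) Filter.atTop (nhds 0) := by
    refine squeeze_zero (fun m => (hp01 _ x y a b).1) (fun m => hpl (f m) x y a b hlose) ?_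
    exact tendsto_one_div_add_atTop_nhds_zero_nat.comp hf.tendsto_atTop
  exact tendsto_nhds_unique hl hz

section

open scoped Matrix.Norms.L2Operator

/-- Trace of a product of projections. -/
theorem trace_proj_mul {ι : Type} [Fintype ι] [DecidableEq ι] (P Q : Matrix ι ι ℂ)
    (hP : P.IsHermitian) (hP2 : P * P = P) (hQ : Q.IsHermitian) (hQ2 : Q * Q = Q) :
    ((P * Q).trace.re : ℂ) = (P * Q).trace ∧ 0 ≤ (P * Q).trace.re := by
  have h1 : (P * Q).trace = ((P * Q)ᴴ * (P * Q)).trace := by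
    rw [Matrix.conjTranspose_mul, hP.eq, hQ.eq, Matrix.mul_assoc, ← Matrix.mul_assoc P, hP2,
      Matrix.trace_mul_comm Q, Matrix.mul_assoc, hQ2]
  have h2 : (P * Q).trace = ((∑ j, ∑ i, ‖(P * Q) i j‖ ^ 2 : ℝ) : ℂ) := by
    rw [h1]
    simp only [Matrix.trace, Matrix.diag, Matrix.mul_apply (M := (P * Q)ᴴ),
      Matrix.conjTranspose_apply]
    push_cast
    refine Finset.sum_congr rfl fun j _ => Finset.sum_congr rfl fun i _ => ?_
    rw [RCLike.star_def, Complex.conj_mul']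
  rw [h2]
  refine ⟨by rw [Complex.ofReal_re], ?_⟩
  rw [Complex.ofReal_re]
  positivity

theorem norm_apply_le_l2 {ι : Type} [Fintype ι] [DecidableEq ι] (M : Matrix ι ι ℂ) (i j : ι) :
    ‖M i j‖ ≤ ‖M‖ := by
  have h := Matrix.l2_opNorm_mulVec M (EuclideanSpace.single j 1)
  rw [PiLp.norm_single, norm_one, mul_one] at h
  refine le_trans ?_ h
  refine le_trans (le_of_eq ?_) (PiLp.norm_apply_le _ i)
  simp

theorem norm_trace_le_l2 {ι : Type} [Fintype ι] [DecidableEq ι] (M : Matrix ι ι ℂ) :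
    ‖M.trace‖ ≤ Fintype.card ι * ‖M‖ := by
  refine le_trans (norm_sum_le _ _) ?_
  refine le_trans (Finset.sum_le_sum fun i _ => norm_apply_le_l2 M i i) ?_
  simp

theorem norm_proj_le {ι : Type} [Fintype ι] [DecidableEq ι] (P : Matrix ι ι ℂ)
    (hP : P.IsHermitian) (hP2 : P * P = P) : ‖P‖ ≤ 1 := by
  have := Matrix.l2_opNorm_conjTranspose_mul_self P
  rw [hP.eq, hP2] at this
  by_contra hc
  push Not at hc
  nlinarith

end


section

open scoped Matrix.Norms.L2Operator

/-- Spectral projection of an involution. -/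
def hpr {ι : Type} [DecidableEq ι] (X : Matrix ι ι ℂ) (g : ℤˣ) : Matrix ι ι ℂ :=
  (1 / 2 : ℂ) • (1 + ((g : ℤ) : ℂ) • X)

section hpr

variable {ι : Type} [Fintype ι] [DecidableEq ι]

theorem hpr_herm (X : Matrix ι ι ℂ) (hX : X.IsHermitian) (g : ℤˣ) : (hpr X g).IsHermitian := by
  rw [Matrix.IsHermitian, hpr, Matrix.conjTranspose_smul, Matrix.conjTranspose_add,
    Matrix.conjTranspose_smul, hX.eq]
  simp

theorem units_sq_C (g : ℤˣ) : ((g : ℤ) : ℂ) * ((g : ℤ) : ℂ) = 1 := by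
  rw [← Int.cast_mul, ← Units.val_mul, Int.units_mul_self]; simp

theorem hpr_mul_self (X : Matrix ι ι ℂ) (hX : X * X = 1) (g : ℤˣ) :
    hpr X g * X = ((g : ℤ) : ℂ) • hpr X g := by
  rcases Int.units_eq_one_or g with rfl | rfl <;>
    simp only [hpr, Units.val_one, Units.val_neg, Int.cast_one, Int.cast_neg, Matrix.smul_mul,
      Matrix.add_mul, Matrix.one_mul, hX] <;> module

theorem hpr_idem (X : Matrix ι ι ℂ) (hX : X * X = 1) (g : ℤˣ) :
    hpr X g * hpr X g = hpr X g := by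
  rcases Int.units_eq_one_or g with rfl | rfl <;>
    simp only [hpr, Units.val_one, Units.val_neg, Int.cast_one, Int.cast_neg, Matrix.smul_mul,
      Matrix.mul_smul, Matrix.mul_add, Matrix.add_mul, Matrix.one_mul, Matrix.mul_one, hX] <;>
    module

theorem hpr_sum (X : Matrix ι ι ℂ) : ∑ g : ℤˣ, hpr X g = 1 := by
  have : (Finset.univ : Finset ℤˣ) = {1, -1} := rfl
  rw [this, Finset.sum_insert (by decide), Finset.sum_singleton]
  simp only [hpr, Units.val_one, Units.val_neg, Int.cast_one, Int.cast_neg]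
  module

theorem hpr_comm (X Y : Matrix ι ι ℂ) (h : X * Y = Y * X) (g k : ℤˣ) :
    hpr X g * hpr Y k = hpr Y k * hpr X g := by
  simp only [hpr, Matrix.smul_mul, Matrix.mul_smul, Matrix.add_mul, Matrix.mul_add,
    Matrix.one_mul, Matrix.mul_one, h]
  module

theorem hpr_comm' (X Y : Matrix ι ι ℂ) (h : X * Y = Y * X) (g : ℤˣ) :
    hpr X g * Y = Y * hpr X g := by
  simp only [hpr, Matrix.smul_mul, Matrix.mul_smul, Matrix.add_mul, Matrix.mul_add,
    Matrix.one_mul, Matrix.mul_one, h]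

/-- The joint spectral projection of an equation. -/
theorem joint_facts (X : Fin 3 → Matrix ι ι ℂ) (hH : ∀ i, (X i).IsHermitian)
    (h2 : ∀ i, X i * X i = 1) (hc : X 0 * X 1 = X 1 * X 0) (c : ℤˣ)
    (h3 : X 2 = ((c : ℤ) : ℂ) • (X 0 * X 1)) (γ : Fin 3 → ℤˣ) (hγ : γ 0 * γ 1 * γ 2 = c) :
    (hpr (X 0) (γ 0) * hpr (X 1) (γ 1)).IsHermitian ∧
    (hpr (X 0) (γ 0) * hpr (X 1) (γ 1)) * (hpr (X 0) (γ 0) * hpr (X 1) (γ 1))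
      = hpr (X 0) (γ 0) * hpr (X 1) (γ 1) ∧
    (∀ i, (hpr (X 0) (γ 0) * hpr (X 1) (γ 1)) * X i
      = ((γ i : ℤ) : ℂ) • (hpr (X 0) (γ 0) * hpr (X 1) (γ 1))) := by
  have hcm := hpr_comm (X 0) (X 1) hc (γ 0) (γ 1)
  have e0 : (hpr (X 0) (γ 0) * hpr (X 1) (γ 1)) * X 0
      = ((γ 0 : ℤ) : ℂ) • (hpr (X 0) (γ 0) * hpr (X 1) (γ 1)) := by
    rw [Matrix.mul_assoc, hpr_comm' (X 1) (X 0) hc.symm, ← Matrix.mul_assoc,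
      hpr_mul_self _ (h2 0), Matrix.smul_mul]
  have e1 : (hpr (X 0) (γ 0) * hpr (X 1) (γ 1)) * X 1
      = ((γ 1 : ℤ) : ℂ) • (hpr (X 0) (γ 0) * hpr (X 1) (γ 1)) := by
    rw [Matrix.mul_assoc, hpr_mul_self _ (h2 1), Matrix.mul_smul]
  refine ⟨?_, ?_, ?_⟩
  · rw [Matrix.IsHermitian, Matrix.conjTranspose_mul, (hpr_herm _ (hH 0) _).eq,
      (hpr_herm _ (hH 1) _).eq, hcm]
  · calc _ = hpr (X 0) (γ 0) * (hpr (X 1) (γ 1) * hpr (X 0) (γ 0)) * hpr (X 1) (γ 1) := by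
          simp only [Matrix.mul_assoc]
      _ = (hpr (X 0) (γ 0) * hpr (X 0) (γ 0)) * (hpr (X 1) (γ 1) * hpr (X 1) (γ 1)) := by
          rw [← hcm]; simp only [Matrix.mul_assoc]
      _ = _ := by rw [hpr_idem _ (h2 0), hpr_idem _ (h2 1)]
  · intro i
    fin_cases i
    · exact e0
    · exact e1
    · show _ * X 2 = ((γ 2 : ℤ) : ℂ) • _
      rw [h3, Matrix.mul_smul, ← Matrix.mul_assoc, e0, Matrix.smul_mul, e1, smul_smul, smul_smul]
      congr 1
      rw [← hγ]
      push_cast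
      linear_combination ((γ 2 : ℤ) : ℂ) * (((γ 1 : ℤ) : ℂ) * ((γ 1 : ℤ) : ℂ)) * units_sq_C (γ 0)
        + ((γ 2 : ℤ) : ℂ) * units_sq_C (γ 1)

theorem overlap_bound [Nonempty ι] (P Q X Y : Matrix ι ι ℂ) (hP : P.IsHermitian)
    (hP2 : P * P = P) (hQ : Q.IsHermitian) (hQ2 : Q * Q = Q) (hY : Y.IsHermitian)
    (g k : ℤˣ) (hgk : g ≠ k)
    (hPX : P * X = ((g : ℤ) : ℂ) • P) (hQY : Q * Y = ((k : ℤ) : ℂ) • Q) :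
    (P * Q).trace.re / (Fintype.card ι : ℝ) ≤ ‖X - Y‖ := by
  have hYQ : Y * Q = ((k : ℤ) : ℂ) • Q := by
    have := congrArg Matrix.conjTranspose hQY
    rw [Matrix.conjTranspose_mul, Matrix.conjTranspose_smul, hQ.eq, hY.eq] at this
    simpa using this
  have hk : k = -g := by
    rcases Int.units_eq_one_or g with rfl | rfl <;> rcases Int.units_eq_one_or k with rfl | rfl <;>
      simp_all
  have h1 : P * (X - Y) * Q = (2 * ((g : ℤ) : ℂ)) • (P * Q) := by
    rw [Matrix.mul_sub, Matrix.sub_mul, hPX, Matrix.mul_assoc P Y, hYQ, hk, Matrix.smul_mul,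
      Matrix.mul_smul]
    push_cast
    module
  have h2 : ‖(P * (X - Y) * Q).trace‖ ≤ Fintype.card ι * ‖X - Y‖ := by
    refine (norm_trace_le_l2 _).trans ?_
    gcongr
    calc ‖P * (X - Y) * Q‖ ≤ ‖P‖ * ‖X - Y‖ * ‖Q‖ :=
          (norm_mul_le _ _).trans (by gcongr; exact norm_mul_le _ _)
      _ ≤ 1 * ‖X - Y‖ * 1 := by
          gcongr
          · exact norm_proj_le P hP hP2
          · exact norm_proj_le Q hQ hQ2
      _ = _ := by ring
  have h3 : ‖(P * (X - Y) * Q).trace‖ = 2 * ‖(P * Q).trace‖ := by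
    rw [h1, Matrix.trace_smul, norm_smul, norm_mul]
    rcases Int.units_eq_one_or g with rfl | rfl <;> simp
  have h4 : (P * Q).trace.re ≤ ‖(P * Q).trace‖ := Complex.re_le_norm _
  have hn : (0 : ℝ) < Fintype.card ι := by exact_mod_cast Fintype.card_pos
  rw [div_le_iff₀ hn]
  have := norm_nonneg (P * Q).trace
  nlinarith

end hpr

end

theorem sum_sol {A : Type} [AddCommMonoid A] (c : ℤˣ) (f : ℤˣ → ℤˣ → A) :
    ∑ β : {β : Fin 3 → ℤˣ // β 0 * β 1 * β 2 = c}, f (β.1 0) (β.1 1)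
      = ∑ g, ∑ h, f g h := by
  rw [← Fintype.sum_prod_type']
  refine Fintype.sum_bijective (fun β => (β.1 0, β.1 1)) ⟨?_, ?_⟩ _ _ (fun _ => rfl)
  · rintro ⟨β, hβ⟩ ⟨β', hβ'⟩ h
    simp only [Prod.mk.injEq] at h
    apply Subtype.ext
    funext i
    fin_cases i
    · exact h.1
    · exact h.2
    · have := hβ.trans hβ'.symm
      rw [h.1, h.2] at this
      exact mul_left_cancel this
  · rintro ⟨g, h⟩
    refine ⟨⟨![g, h, c * g * h], ?_⟩, rfl⟩
    simp only [Matrix.cons_val_zero, Matrix.cons_val_one, Matrix.cons_val]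
    have hg := Int.units_mul_self g
    have hh := Int.units_mul_self h
    calc g * h * (c * g * h) = (g * g) * (h * h) * c := by
          simp only [mul_comm, mul_left_comm]
      _ = c := by rw [hg, hh, one_mul, one_mul]

theorem relSame_of_consistent {Var Eqn : Type} (s : Eqn → Fin 3 → Var)
    (hs : ∀ k, Function.Injective (s k)) (b : Eqn → ℤˣ)
    (v v' : SV (fun _ : Eqn => (1 : ℤˣ))) (w w' : SV b) (h1 : v.1 = w.1) (h2 : v'.1 = w'.1)
    (hcon : ∀ i j, s v.1 i = s v'.1 j → v.2.1 i * w.2.1 i = v'.2.1 j * w'.2.1 j) :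
    relSame (SG s hs (fun _ => 1)) (SG s hs b) v v' w w' := by
  obtain ⟨k, α, hα⟩ := v
  obtain ⟨l, α', hα'⟩ := v'
  obtain ⟨k', β, hβ⟩ := w
  obtain ⟨l', β', hβ'⟩ := w'
  simp only at h1 h2 hcon
  subst h1 h2
  have hadj : (SG s hs (fun _ => 1)).Adj ⟨k, α, hα⟩ ⟨l, α', hα'⟩ ↔
      (SG s hs b).Adj ⟨k, β, hβ⟩ ⟨l, β', hβ'⟩ := by
    constructor
    · rintro ⟨i, j, hij, hne⟩
      refine ⟨i, j, hij, fun he => hne ?_⟩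
      have := hcon i j hij
      simp only at he
      rw [he] at this
      exact mul_right_cancel this
    · rintro ⟨i, j, hij, hne⟩
      refine ⟨i, j, hij, fun he => hne ?_⟩
      have := hcon i j hij
      simp only at he
      rw [he] at this
      exact mul_left_cancel this
  have heq : ((⟨k, α, hα⟩ : SV (fun _ : Eqn => (1 : ℤˣ))) = ⟨l, α', hα'⟩) ↔
      ((⟨k, β, hβ⟩ : SV b) = ⟨l, β', hβ'⟩) := by
    by_cases hkl : k = l
    · subst hkl
      have hcon' : ∀ i, α i * β i = α' i * β' i := fun i => hcon i i rfl
      simp only [Sigma.mk.injEq, heq_eq_eq, true_and, Subtype.mk.injEq]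
      constructor
      · rintro rfl
        funext i
        exact mul_left_cancel (hcon' i)
      · rintro rfl
        funext i
        exact mul_right_cancel (hcon' i)
    · simp [hkl]
  simp only [relSame, hadj, heq, ne_eq]
  tauto


section

open scoped Matrix.Norms.L2Operator

/-- The entries of the magic unitary attached to an operator solution. -/
def mg {Var0 Eqn ι : Type} [DecidableEq Eqn] [Fintype ι] [DecidableEq ι]
    (s0 : Eqn → Fin 3 → Var0) (X : Var0 → Matrix ι ι ℂ) (b : Eqn → ℤˣ)
    (v : SV (fun _ : Eqn => (1 : ℤˣ))) (w : SV b) : Matrix ι ι ℂ :=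
  if v.1 = w.1 then hpr (X (s0 v.1 0)) (v.2.1 0 * w.2.1 0) *
    hpr (X (s0 v.1 1)) (v.2.1 1 * w.2.1 1) else 0

/-- The measurement operators of the isomorphism game. -/
def mgE {Var0 Eqn ι : Type} [DecidableEq Eqn] [Fintype ι] [DecidableEq ι]
    (s0 : Eqn → Fin 3 → Var0) (X : Var0 → Matrix ι ι ℂ) (b : Eqn → ℤˣ) :
    (SV (fun _ : Eqn => (1 : ℤˣ)) ⊕ SV b) → (SV (fun _ : Eqn => (1 : ℤˣ)) ⊕ SV b) →
      Matrix ι ι ℂ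
  | Sum.inl v, Sum.inr w => mg s0 X b v w
  | Sum.inr w, Sum.inl v => mg s0 X b v w
  | _, _ => 0

theorem sum_shift {ι : Type} [Fintype ι] [DecidableEq ι] (A B : Matrix ι ι ℂ) (c : ℤˣ)
    (u0 u1 : ℤˣ) :
    ∑ β : {β : Fin 3 → ℤˣ // β 0 * β 1 * β 2 = c},
      hpr A (u0 * β.1 0) * hpr B (u1 * β.1 1) = 1 := by
  rw [sum_sol c (fun g h => hpr A (u0 * g) * hpr B (u1 * h))]
  simp only [← Finset.mul_sum, ← Finset.sum_mul]
  have hA : ∑ g, hpr A (u0 * g) = ∑ g, hpr A g :=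
    Equiv.sum_comp (Equiv.mulLeft u0) (fun g => hpr A g)
  have hB : ∑ g, hpr B (u1 * g) = ∑ g, hpr B g :=
    Equiv.sum_comp (Equiv.mulLeft u1) (fun g => hpr B g)
  rw [hA, hB, hpr_sum, hpr_sum, one_mul]

theorem mg_row {Var0 Eqn ι : Type} [Fintype Eqn] [DecidableEq Eqn] [Fintype ι] [DecidableEq ι]
    (s0 : Eqn → Fin 3 → Var0) (X : Var0 → Matrix ι ι ℂ) (b : Eqn → ℤˣ)
    (v : SV (fun _ : Eqn => (1 : ℤˣ))) : ∑ w, mg s0 X b v w = 1 := by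
  rw [← Finset.univ_sigma_univ, Finset.sum_sigma, Finset.sum_eq_single v.1]
  · simp only [mg, if_true]
    exact sum_shift _ _ _ _ _
  · intro k _ hk
    simp [mg, hk.symm]
  · simp

theorem mg_col {Var0 Eqn ι : Type} [Fintype Eqn] [DecidableEq Eqn] [Fintype ι] [DecidableEq ι]
    (s0 : Eqn → Fin 3 → Var0) (X : Var0 → Matrix ι ι ℂ) (b : Eqn → ℤˣ)
    (w : SV b) : ∑ v, mg s0 X b v w = 1 := by
  rw [← Finset.univ_sigma_univ, Finset.sum_sigma, Finset.sum_eq_single w.1]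
  · simp only [mg, if_true]
    simp only [mul_comm _ (w.2.1 0), mul_comm _ (w.2.1 1)]
    exact sum_shift _ _ _ _ _
  · intro k _ hk
    simp [mg, hk]
  · simp

theorem qaiso_of_approx {Var0 Var Eqn : Type} [Fintype Eqn] [DecidableEq Eqn]
    (s0 : Eqn → Fin 3 → Var0) (q : Var0 → Var)
    (hs : ∀ k, Function.Injective (fun i => q (s0 k i))) (b : Eqn → ℤˣ)
    (h : ∀ ε : ℝ, 0 < ε → ∃ (ι : Type) (_ : Fintype ι) (_ : DecidableEq ι) (_ : Nonempty ι)
      (X : Var0 → Matrix ι ι ℂ), (∀ v, (X v).IsHermitian ∧ X v * X v = 1) ∧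
        (∀ k, X (s0 k 0) * X (s0 k 1) = X (s0 k 1) * X (s0 k 0)) ∧
        (∀ k, X (s0 k 2) = ((b k : ℤ) : ℂ) • (X (s0 k 0) * X (s0 k 1))) ∧
        ∀ v w, q v = q w → ‖X v - X w‖ ≤ ε) :
    QAIso (SG (fun k i => q (s0 k i)) hs (fun _ => 1)) (SG (fun k i => q (s0 k i)) hs b) := by
  apply perfectQA_of_approx
  intro ε hε
  obtain ⟨ι, i1, i2, i3, X, hX, hXc, hX3, hXq⟩ := h ε hε
  have facts : ∀ (v : SV (fun _ : Eqn => (1 : ℤˣ))) (w : SV b), v.1 = w.1 →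
      (mg s0 X b v w).IsHermitian ∧ mg s0 X b v w * mg s0 X b v w = mg s0 X b v w ∧
      ∀ i, mg s0 X b v w * X (s0 v.1 i)
        = (((v.2.1 i * w.2.1 i : ℤˣ) : ℤ) : ℂ) • mg s0 X b v w := by
    intro v w hvw
    simp only [mg, if_pos hvw]
    refine joint_facts (fun i => X (s0 v.1 i)) (fun i => (hX _).1) (fun i => (hX _).2)
      (hXc _) (b w.1) ?_ (fun i => v.2.1 i * w.2.1 i) ?_
    · rw [← hvw]; exact hX3 _
    · have h1 : v.2.1 0 * v.2.1 1 * v.2.1 2 = 1 := v.2.2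
      have h2 := w.2.2
      calc v.2.1 0 * w.2.1 0 * (v.2.1 1 * w.2.1 1) * (v.2.1 2 * w.2.1 2)
          = (v.2.1 0 * v.2.1 1 * v.2.1 2) * (w.2.1 0 * w.2.1 1 * w.2.1 2) := by
            generalize v.2.1 0 = x0, v.2.1 1 = x1, v.2.1 2 = x2, w.2.1 0 = y0, w.2.1 1 = y1,
              w.2.1 2 = y2
            rw [mul_mul_mul_comm x0, mul_mul_mul_comm (x0 * x1)]
        _ = b w.1 := by rw [h1, one_mul]; exact h2
  have hE : ∀ x a, (mgE s0 X b x a).IsHermitian ∧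
      mgE s0 X b x a * mgE s0 X b x a = mgE s0 X b x a := by
    have hm : ∀ v w, (mg s0 X b v w).IsHermitian ∧
        mg s0 X b v w * mg s0 X b v w = mg s0 X b v w := by
      intro v w
      by_cases hvw : v.1 = w.1
      · exact ⟨(facts v w hvw).1, (facts v w hvw).2.1⟩
      · simp [mg, hvw]
    rintro (x | x) (a | a)
    · simp [mgE]
    · exact hm _ _
    · exact hm _ _
    · simp [mgE]
  have hE1 : ∀ x, ∑ a, mgE s0 X b x a = 1 := by
    rintro (x | x)
    · rw [Fintype.sum_sum_type]
      simp only [mgE, Finset.sum_const_zero, zero_add]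
      exact mg_row _ _ _ _
    · rw [Fintype.sum_sum_type]
      simp only [mgE, Finset.sum_const_zero, add_zero]
      exact mg_col _ _ _ _
  have hn : (0 : ℝ) < Fintype.card ι := by exact_mod_cast Fintype.card_pos
  have htp := fun x y a c => trace_proj_mul (mgE s0 X b x a) (mgE s0 X b y c)
    (hE x a).1 (hE x a).2 (hE y c).1 (hE y c).2
  refine ⟨fun x y a c => (mgE s0 X b x a * mgE s0 X b y c).trace.re / (Fintype.card ι : ℝ),
    trace_mem_QCorr (mgE s0 X b) hE hE1 _ ?_, ?_, ?_⟩
  · intro x y a c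
    rw [Complex.ofReal_div, (htp x y a c).1]
    simp
  · intro x y a c
    refine ⟨div_nonneg (htp x y a c).2 hn.le, ?_⟩
    rw [div_le_one hn]
    refine (Complex.re_le_norm _).trans ((norm_trace_le_l2 _).trans ?_)
    have h1 := norm_proj_le _ (hE x a).1 (hE x a).2
    have h2 := norm_proj_le _ (hE y c).1 (hE y c).2
    have h3 := norm_mul_le (mgE s0 X b x a) (mgE s0 X b y c)
    have : ‖mgE s0 X b x a * mgE s0 X b y c‖ ≤ 1 :=
      h3.trans (mul_le_one₀ h1 (norm_nonneg _) h2)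
    nlinarith
  · have main : ∀ v v' w w', ¬ relSame (SG (fun k i => q (s0 k i)) hs (fun _ => 1))
        (SG (fun k i => q (s0 k i)) hs b) v v' w w' →
        (mg s0 X b v w * mg s0 X b v' w').trace.re / (Fintype.card ι : ℝ) ≤ ε := by
      intro v v' w w' hrel
      by_cases h1 : v.1 = w.1
      · by_cases h2 : v'.1 = w'.1
        · have hex : ∃ i j, q (s0 v.1 i) = q (s0 v'.1 j) ∧
              v.2.1 i * w.2.1 i ≠ v'.2.1 j * w'.2.1 j := by
            by_contra hcon
            push Not at hcon
            exact hrel (relSame_of_consistent (fun k i => q (s0 k i)) hs b v v' w w' h1 h2 hcon)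
          obtain ⟨i, j, hij, hne⟩ := hex
          have f1 := facts v w h1
          have f2 := facts v' w' h2
          exact (overlap_bound _ _ (X (s0 v.1 i)) (X (s0 v'.1 j)) f1.1 f1.2.1 f2.1 f2.2.1
            (hX _).1 _ _ hne (f1.2.2 i) (f2.2.2 j)).trans (hXq _ _ hij)
        · simp [mg, h2, hε.le]
      · simp [mg, h1, hε.le]
    intro x y a c hlose
    have hz : ∀ v v' w w', pairIO x a = some (v, w) → pairIO y c = some (v', w') →
        ¬ relSame (SG (fun k i => q (s0 k i)) hs (fun _ => 1))
        (SG (fun k i => q (s0 k i)) hs b) v v' w w' := by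
      intro v v' w w' h1 h2 h3
      exact hlose ⟨v, w, v', w', h1, h2, h3⟩
    rcases x with x | x <;> rcases a with a | a <;> rcases y with y | y <;> rcases c with c | c <;>
      simp only [mgE, zero_mul, mul_zero, Matrix.trace_zero, Complex.zero_re, zero_div, hε.le] <;>
      exact main _ _ _ _ (hz _ _ _ _ rfl rfl)

end


/-! ### The concrete linear system -/

/-- Main variables of the linear system. -/
inductive MainV : Type
  | U | V | U2 | V2 | B1 | B2 | B3 | P | W1 | W2 | a1 | a2 | Vb | c1 | c2 | c3

/-- Local variables of a conjugation gadget. -/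
inductive LocV : Type
  | A | B | D | CD | AC | BD | E | F | T

/-- All variables. -/
inductive AllV : Type
  | m : MainV → AllV
  | g : Fin 7 → LocV → AllV

/-- Identification of the two versions of `W`. -/
def qV : AllV → AllV
  | .m .W2 => .m .W1
  | v => v

/-- The conjugating variable of a gadget. -/
def gB : Fin 7 → MainV := ![.B1, .B1, .B3, .B2, .B2, .a1, .a2]
/-- The conjugated variable of a gadget. -/
def gC : Fin 7 → MainV := ![.U, .V, .U2, .U2, .V2, .V, .V]
/-- The output variable of a gadget. -/
def gZ : Fin 7 → MainV := ![.U2, .V2, .W1, .U, .W2, .Vb, .Vb]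
/-- The sign of a gadget. -/
def gS : Fin 7 → ℤˣ := ![1, 1, 1, 1, 1, 1, -1]

/-- The index set of equations. -/
abbrev EqI : Type := Fin 5 ⊕ (Fin 7 × Fin 8)

/-- Equations of a gadget. -/
def gadS (g : Fin 7) : Fin 8 → Fin 3 → AllV :=
  ![![.g g .A, .m (gB g), .g g .B],
    ![.m (gC g), .g g .D, .g g .CD],
    ![.g g .AC, .g g .BD, .g g .E],
    ![.g g .A, .m (gC g), .g g .AC],
    ![.g g .B, .g g .D, .g g .BD],
    ![.m (gB g), .g g .CD, .g g .F],
    ![.g g .E, .g g .F, .g g .T],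
    ![.m (gC g), .g g .T, .m (gZ g)]]

/-- Main equations. -/
def mainS : Fin 5 → Fin 3 → AllV :=
  ![![.m .V, .m .V2, .m .P],
    ![.m .P, .m .B1, .m .B3],
    ![.m .U, .m .V2, .m .c1],
    ![.m .U, .m .a1, .m .c2],
    ![.m .U, .m .a2, .m .c3]]

/-- All equations. -/
def sysS : EqI → Fin 3 → AllV
  | Sum.inl k => mainS k
  | Sum.inr gk => gadS gk.1 gk.2

/-- Right-hand sides. -/
def sysB : EqI → ℤˣ
  | Sum.inl _ => 1
  | Sum.inr gk => ![1, 1, 1, 1, 1, 1, 1, gS gk.1] gk.2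

theorem inj3 {α : Type} (f : Fin 3 → α) (h1 : f 0 ≠ f 1) (h2 : f 0 ≠ f 2) (h3 : f 1 ≠ f 2) :
    Function.Injective f := by
  intro i j hij
  fin_cases i <;> fin_cases j <;> simp_all

theorem sys_inj (k : EqI) : Function.Injective (fun i => qV (sysS k i)) := by
  rcases k with k | ⟨g, k⟩
  · fin_cases k <;> refine inj3 _ ?_ ?_ ?_ <;> simp [sysS, mainS, qV]
  · fin_cases g <;> fin_cases k <;> refine inj3 _ ?_ ?_ ?_ <;>
      simp [sysS, gadS, qV, gB, gC, gZ]

/-! ### No finite-dimensional solution -/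

theorem gadget_alg {R : Type} [Ring R] (A B D CD AC BD E F T b C Z σ : R)
    (hA : A * A = 1) (hC : C * C = 1) (hD : D * D = 1)
    (hAC : A * C = C * A) (hbCD : b * CD = CD * b) (hCD : C * D = D * C)
    (e1 : B = A * b) (e2 : CD = C * D) (e3 : E = AC * BD) (e4 : AC = A * C) (e5 : BD = B * D)
    (e6 : F = b * CD) (e7 : T = E * F) (e8 : Z = σ * (C * T)) : Z = σ * (b * C * b) := by
  have h1 : E = C * b * D := by
    rw [e3, e4, e5, e1, hAC]
    calc C * A * (A * b * D) = C * (A * A) * b * D := by noncomm_ring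
      _ = _ := by rw [hA, mul_one]
  have h2 : F = D * C * b := by rw [e6, hbCD, e2, hCD]
  rw [e8, e7, h1, h2]
  calc σ * (C * (C * b * D * (D * C * b))) = σ * ((C * C) * b * (D * D) * C * b) := by noncomm_ring
    _ = _ := by rw [hC, hD, mul_one, one_mul]

theorem spec_contra {R : Type} [AddCommGroup R] [Module ℂ R] [FiniteDimensional ℂ R]
    [Nontrivial R] (x y a : (Module.End ℂ R)ˣ)
    (hx : (x : Module.End ℂ R) * y * ((x⁻¹ : (Module.End ℂ R)ˣ) : Module.End ℂ R) = y * y)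
    (ha : (a : Module.End ℂ R) * y * ((a⁻¹ : (Module.End ℂ R)ˣ) : Module.End ℂ R)
      = -(y : Module.End ℂ R)) : False := by
  have hyu : IsUnit y.val := y.isUnit
  generalize y.val = Y at hx ha hyu
  have hfin : (spectrum ℂ Y).Finite := Module.End.finite_spectrum Y
  have hne : (spectrum ℂ Y).Nonempty := spectrum.nonempty_of_isAlgClosed_of_finiteDimensional ℂ Y
  have h2 : spectrum ℂ Y = (fun z => z ^ 2) '' spectrum ℂ Y := by
    rw [← spectrum.map_pow_of_pos Y (by norm_num : 0 < 2), pow_two, ← hx, spectrum.units_conjugate]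
  have hneg : spectrum ℂ Y = - spectrum ℂ Y := by
    rw [spectrum.neg_eq, ← ha, spectrum.units_conjugate]
  obtain ⟨l, hl⟩ := hne
  have hl0 : l ≠ 0 := by
    rintro rfl
    exact spectrum.zero_notMem ℂ hyu hl
  have hinj : Set.InjOn (fun z : ℂ => z ^ 2) (spectrum ℂ Y) := by
    apply Set.injOn_of_ncard_image_eq _ hfin
    rw [← h2]
  have hl' : -l ∈ spectrum ℂ Y := by rw [hneg]; simpa using hl
  have : l = -l := hinj hl hl' (by simp)
  exact hl0 (by simpa [eq_neg_iff_add_eq_zero] using this)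


theorem third_of_prod {R : Type} [Ring R] (x y z : R) (c : ℤˣ) (hz : z * z = 1)
    (h : x * y * z = (((c : ℤˣ) : ℤ) : R)) : z = (((c : ℤˣ) : ℤ) : R) * (x * y) := by
  have h1 : x * y = (((c : ℤˣ) : ℤ) : R) * z := by
    rw [← h, mul_assoc (x * y), hz, mul_one]
  rw [h1, ← mul_assoc, ← Int.cast_mul, ← Units.val_mul, Int.units_mul_self]
  simp

theorem core_alg {R : Type} [Ring R] (U V U2 V2 B1 B2 B3 P W a1 a2 Vb : R)
    (hU : U * U = 1) (hV : V * V = 1) (hV2 : V2 * V2 = 1) (hB1 : B1 * B1 = 1) (hB2 : B2 * B2 = 1)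
    (ha1 : a1 * a1 = 1) (ha2 : a2 * a2 = 1)
    (g1 : U2 = B1 * U * B1) (g2 : V2 = B1 * V * B1) (g3 : W = B3 * U2 * B3)
    (g4 : U = B2 * U2 * B2) (g5 : W = B2 * V2 * B2) (g6 : Vb = a1 * V * a1)
    (g7 : Vb = -(a2 * V * a2)) (m1 : P = V * V2) (c1 : V * V2 = V2 * V) (m2 : B3 = P * B1)
    (c2 : P * B1 = B1 * P) (c3 : U * V2 = V2 * U) (c4 : U * a1 = a1 * U) (c5 : U * a2 = a2 * U) :
    ∃ x y a : Rˣ, (x : R) * y * ((x⁻¹ : Rˣ) : R) = y * y ∧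
      (a : R) * y * ((a⁻¹ : Rˣ) : R) = -(y : R) := by
  have hW : W = V * U * V := by
    have : W = P * U * P := by
      rw [g3, g1]
      nth_rw 2 [m2]
      rw [c2, m2]
      calc P * B1 * (B1 * U * B1) * (B1 * P) = P * (B1 * B1) * U * (B1 * B1) * P := by noncomm_ring
        _ = _ := by rw [hB1, mul_one, mul_one]
    rw [this]
    nth_rw 2 [m1]
    rw [c1, m1]
    calc V * V2 * U * (V2 * V) = V * (V2 * U) * V2 * V := by noncomm_ring
      _ = V * U * (V2 * V2) * V := by rw [← c3]; noncomm_ring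
      _ = _ := by rw [hV2, mul_one]
  have hxU : B2 * B1 * U * (B1 * B2) = U := by
    conv_rhs => rw [g4, g1]
    noncomm_ring
  have hxV : B2 * B1 * V * (B1 * B2) = V * U * V := by
    rw [← hW, g5, g2]
    noncomm_ring
  have haU : a2 * a1 * U * (a1 * a2) = U := by
    calc a2 * a1 * U * (a1 * a2) = a2 * (a1 * U) * a1 * a2 := by noncomm_ring
      _ = a2 * U * (a1 * a1) * a2 := by rw [← c4]; noncomm_ring
      _ = U * (a2 * a2) := by rw [ha1, mul_one, ← c5, mul_assoc]
      _ = U := by rw [ha2, mul_one]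
  have haV : a2 * a1 * V * (a1 * a2) = -V := by
    calc a2 * a1 * V * (a1 * a2) = a2 * (a1 * V * a1) * a2 := by noncomm_ring
      _ = a2 * (-(a2 * V * a2)) * a2 := by rw [← g6, g7]
      _ = -((a2 * a2) * V * (a2 * a2)) := by noncomm_ring
      _ = _ := by rw [ha2, one_mul, mul_one]
  have inv : ∀ p q : R, p * p = 1 → q * q = 1 → (p * q) * (q * p) = 1 := by
    intro p q hp hq
    rw [mul_assoc, ← mul_assoc q, hq, one_mul, hp]
  refine ⟨⟨B2 * B1, B1 * B2, inv _ _ hB2 hB1, inv _ _ hB1 hB2⟩,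
    ⟨U * V, V * U, inv _ _ hU hV, inv _ _ hV hU⟩,
    ⟨a2 * a1, a1 * a2, inv _ _ ha2 ha1, inv _ _ ha1 ha2⟩, ?_, ?_⟩
  · show B2 * B1 * (U * V) * (B1 * B2) = U * V * (U * V)
    calc B2 * B1 * (U * V) * (B1 * B2)
        = B2 * B1 * U * (1 * V) * (B1 * B2) := by noncomm_ring
      _ = B2 * B1 * U * ((B1 * B2) * (B2 * B1) * V) * (B1 * B2) := by rw [inv _ _ hB1 hB2]
      _ = (B2 * B1 * U * (B1 * B2)) * (B2 * B1 * V * (B1 * B2)) := by noncomm_ring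
      _ = _ := by rw [hxU, hxV]; noncomm_ring
  · show a2 * a1 * (U * V) * (a1 * a2) = -(U * V)
    calc a2 * a1 * (U * V) * (a1 * a2)
        = a2 * a1 * U * (1 * V) * (a1 * a2) := by noncomm_ring
      _ = a2 * a1 * U * ((a1 * a2) * (a2 * a1) * V) * (a1 * a2) := by rw [inv _ _ ha1 ha2]
      _ = (a2 * a1 * U * (a1 * a2)) * (a2 * a1 * V * (a1 * a2)) := by noncomm_ring
      _ = _ := by rw [haU, haV]; noncomm_ring

theorem sys_alg {R : Type} [Ring R] (X : AllV → R)
    (h1 : ∀ k i, X (qV (sysS k i)) * X (qV (sysS k i)) = 1)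
    (h2 : ∀ k i j, X (qV (sysS k i)) * X (qV (sysS k j)) = X (qV (sysS k j)) * X (qV (sysS k i)))
    (h3 : ∀ k, X (qV (sysS k 0)) * X (qV (sysS k 1)) * X (qV (sysS k 2))
      = (((sysB k : ℤˣ) : ℤ) : R)) :
    ∃ x y a : Rˣ, (x : R) * y * ((x⁻¹ : Rˣ) : R) = y * y ∧
      (a : R) * y * ((a⁻¹ : Rˣ) : R) = -(y : R) := by
  have ht := fun k => third_of_prod _ _ _ _ (h1 k 2) (h3 k)
  have gad : ∀ g : Fin 7, X (qV (.m (gZ g))) =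
      (((gS g : ℤˣ) : ℤ) : R) * (X (qV (.m (gB g))) * X (qV (.m (gC g))) * X (qV (.m (gB g)))) := by
    intro g
    have e := fun k => ht (Sum.inr (g, k))
    have c := fun k => h2 (Sum.inr (g, k)) 0 1
    have e' : ∀ k : Fin 7, X (qV (gadS g k.castSucc 2)) =
        X (qV (gadS g k.castSucc 0)) * X (qV (gadS g k.castSucc 1)) := by
      intro k
      have := e k.castSucc
      have hb : sysB (Sum.inr (g, k.castSucc)) = 1 := by
        fin_cases k <;> rfl
      rw [hb] at this
      simpa [sysS] using this
    exact gadget_alg (X (qV (.g g .A))) (X (qV (.g g .B))) (X (qV (.g g .D))) (X (qV (.g g .CD)))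
      (X (qV (.g g .AC))) (X (qV (.g g .BD))) (X (qV (.g g .E))) (X (qV (.g g .F)))
      (X (qV (.g g .T))) (X (qV (.m (gB g)))) (X (qV (.m (gC g)))) (X (qV (.m (gZ g))))
      (((gS g : ℤˣ) : ℤ) : R) (h1 (Sum.inr (g, 0)) 0) (h1 (Sum.inr (g, 1)) 0)
      (h1 (Sum.inr (g, 1)) 1) (c 3) (c 5) (c 1)
      (e' 0) (e' 1) (e' 2) (e' 3) (e' 4) (e' 5) (e' 6) (e 7)
  have hm : ∀ k, X (qV (mainS k 2)) = X (qV (mainS k 0)) * X (qV (mainS k 1)) := by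
    intro k
    have := ht (Sum.inl k)
    simpa [sysS, sysB] using this
  have cm : ∀ k, X (qV (mainS k 0)) * X (qV (mainS k 1)) =
      X (qV (mainS k 1)) * X (qV (mainS k 0)) := fun k => h2 (Sum.inl k) 0 1
  have sm : ∀ k i, X (qV (mainS k i)) * X (qV (mainS k i)) = 1 := fun k => h1 (Sum.inl k)
  have one : (((1 : ℤˣ) : ℤ) : R) = 1 := by simp
  have g0 := gad 0
  have g1 := gad 1
  have g2 := gad 2
  have g3 := gad 3
  have g4 := gad 4
  have g5 := gad 5
  have g6 := gad 6
  simp [gS, gZ, gB, gC, qV] at g0 g1 g2 g3 g4 g5 g6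
  exact core_alg (X (.m .U)) (X (.m .V)) (X (.m .U2)) (X (.m .V2)) (X (.m .B1)) (X (.m .B2))
    (X (.m .B3)) (X (.m .P)) (X (.m .W1)) (X (.m .a1)) (X (.m .a2)) (X (.m .Vb))
    (sm 2 0) (sm 0 0) (sm 0 1) (sm 1 1) (h1 (Sum.inr (3, 0)) 1) (sm 3 1) (sm 4 1)
    g0 g1 g2 g3 g4 g5 g6 (hm 0) (cm 0) (hm 1) (cm 1) (cm 2) (cm 3) (cm 4)

theorem not_qiso : ¬ QIso (SG (fun k i => qV (sysS k i)) sys_inj (fun _ => 1))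
    (SG (fun k i => qV (sysS k i)) sys_inj sysB) := by
  intro h
  obtain ⟨d, R, hR, X, h1, h2, h3⟩ := lin_of_qiso _ _ _ h
  obtain ⟨x, y, a, hx, ha⟩ := sys_alg X h1 h2 h3
  exact spec_contra x y a hx ha


/-! ### Approximate model: gadgets -/

section

variable {ι : Type} [Fintype ι] [DecidableEq ι]

/-- Observables: Hermitian involutions. -/
def Obs (M : Matrix ι ι ℂ) : Prop := M.IsHermitian ∧ M * M = 1

theorem Obs.mul {M N : Matrix ι ι ℂ} (hM : Obs M) (hN : Obs N) (h : M * N = N * M) :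
    Obs (M * N) := by
  refine ⟨?_, ?_⟩
  · show (M * N)ᴴ = M * N
    rw [Matrix.conjTranspose_mul, hM.1.eq, hN.1.eq, h]
  · calc M * N * (M * N) = M * (N * M) * N := by noncomm_ring
      _ = (M * M) * (N * N) := by rw [← h]; noncomm_ring
      _ = 1 := by rw [hM.2, hN.2, mul_one]

theorem Obs.conj {M N : Matrix ι ι ℂ} (hM : Obs M) (hN : Obs N) : Obs (M * N * M) := by
  refine ⟨?_, ?_⟩
  · show (M * N * M)ᴴ = M * N * M
    rw [Matrix.conjTranspose_mul, Matrix.conjTranspose_mul, hM.1.eq, hN.1.eq, mul_assoc]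
  · calc M * N * M * (M * N * M) = M * (N * (M * M) * N) * M := by noncomm_ring
      _ = 1 := by rw [hM.2, mul_one, hN.2, mul_one, hM.2]

/-- The controlled operator used in the gadget. -/
theorem gadget_G (T X Z : Matrix ι ι ℂ) (hT : Obs T) (hX : Obs X) (hZ : Obs Z)
    (hTX : Commute T X) (hTZ : Commute T Z) (hXZ : X * Z = -(Z * X)) :
    ∃ G : Matrix ι ι ℂ, Obs G ∧ G * X = X * (G * T) ∧
      ∀ Y, Commute Y T → Commute Y Z → Commute Y G := by
  refine ⟨(2⁻¹ : ℂ) • (1 + T + Z - T * Z), ⟨?_, ?_⟩, ?_, ?_⟩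
  · show ((2⁻¹ : ℂ) • (1 + T + Z - T * Z))ᴴ = _
    have : star (2⁻¹ : ℂ) = 2⁻¹ := by simp
    rw [Matrix.conjTranspose_smul, this, Matrix.conjTranspose_sub, Matrix.conjTranspose_mul,
      Matrix.conjTranspose_add, Matrix.conjTranspose_add, Matrix.conjTranspose_one, hT.1.eq,
      hZ.1.eq, hTZ.eq]
  · have e : (1 + T + Z - T * Z) * (1 + T + Z - T * Z) = (4 : ℂ) • (1 : Matrix ι ι ℂ) := by
      have h1 : T * Z * T = Z := by rw [hTZ.eq, mul_assoc, hT.2, mul_one]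
      have h2 : Z * T * Z = T := by rw [← hTZ.eq, mul_assoc, hZ.2, mul_one]
      have h3 : T * Z * (T * Z) = 1 := by rw [← mul_assoc, h1, hZ.2]
      have : (1 + T + Z - T * Z) * (1 + T + Z - T * Z)
          = 1 + T * T + Z * Z + T * Z * (T * Z) + (T + T) + (Z + Z) + (Z * T - T * Z) 
            - T * T * Z - T * Z * T - Z * T * Z - T * (Z * Z) := by noncomm_ring
      rw [this, h1, h2, h3, hT.2, hZ.2, hTZ.eq]
      rw [show (4 : ℂ) = 1 + 1 + 1 + 1 by norm_num, add_smul, add_smul, add_smul, one_smul]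
      noncomm_ring
    rw [smul_mul_smul_comm, e, smul_smul]
    norm_num
  · rw [smul_mul_assoc, smul_mul_assoc, mul_smul_comm]
    congr 1
    have h1 : X * Z * T = -(T * Z * X) := by
      rw [hXZ, neg_mul, mul_assoc, ← hTX.eq, ← mul_assoc, ← hTZ.eq]
    have h2 : X * T * Z * T = -(Z * X) := by
      rw [mul_assoc X, hTZ.eq, mul_assoc X, mul_assoc Z, hT.2, mul_one, hXZ]
    calc (1 + T + Z - T * Z) * X = X + T * X + Z * X - T * Z * X := by noncomm_ring
      _ = X * T + X * (T * T) + X * Z * T - X * T * Z * T := by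
          rw [h1, h2, hT.2, hTX.eq]; noncomm_ring
      _ = _ := by noncomm_ring
  · intro Y h1 h2
    exact ((((Commute.one_right Y).add_right h1).add_right h2).sub_right
      (h1.mul_right h2)).smul_right _

theorem gadget_model (b C X Z : Matrix ι ι ℂ) (hb : Obs b) (hC : Obs C) (hX : Obs X) (hZ : Obs Z)
    (hbX : Commute b X) (hbZ : Commute b Z) (hCX : Commute C X) (hCZ : Commute C Z)
    (hXZ : X * Z = -(Z * X)) (hc : Commute C (b * C * b)) :
    ∃ L : LocV → Matrix ι ι ℂ, (∀ l, Obs (L l)) ∧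
      (L .A * b = b * L .A ∧ C * L .D = L .D * C ∧ L .AC * L .BD = L .BD * L .AC ∧
        L .A * C = C * L .A ∧ L .B * L .D = L .D * L .B ∧ b * L .CD = L .CD * b ∧
        L .E * L .F = L .F * L .E ∧ C * L .T = L .T * C) ∧
      (L .B = L .A * b ∧ L .CD = C * L .D ∧ L .E = L .AC * L .BD ∧ L .AC = L .A * C ∧
        L .BD = L .B * L .D ∧ L .F = b * L .CD ∧ L .T = L .E * L .F ∧ b * C * b = C * L .T) := by
  obtain ⟨T, hTd⟩ : ∃ T, T = C * (b * C * b) := ⟨_, rfl⟩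
  have hT : Obs T := by rw [hTd]; exact hC.mul (hb.conj hC) hc
  have hTC : Commute C T := by rw [hTd]; exact (Commute.refl C).mul_right hc
  have hCT : C * T = b * C * b := by rw [hTd, ← mul_assoc, hC.2, one_mul]
  have hbT : Commute b T := by
    have h1 : b * T = C * b * C := by
      rw [hTd, hc.eq]
      calc b * (b * C * b * C) = (b * b) * C * b * C := by noncomm_ring
        _ = _ := by rw [hb.2, one_mul]
    have h2 : T * b = C * b * C := by
      rw [hTd]
      calc C * (b * C * b) * b = C * b * C * (b * b) := by noncomm_ring
        _ = _ := by rw [hb.2, mul_one]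
    exact h1.trans h2.symm
  have hTX : Commute T X := by
    rw [hTd]; exact hCX.mul_left ((hbX.mul_left hCX).mul_left hbX)
  have hTZ : Commute T Z := by
    rw [hTd]; exact hCZ.mul_left ((hbZ.mul_left hCZ).mul_left hbZ)
  obtain ⟨G, hG, hGX, hGc⟩ := gadget_G T X Z hT hX hZ hTX hTZ hXZ
  have hbG := hGc b hbT hbZ
  have hCG := hGc C hTC hCZ
  have hTG := hGc T (Commute.refl T) hTZ
  have hCTb : C * T * b = b * C := by rw [hCT, mul_assoc, hb.2, mul_one]
  -- the two nontrivial commutations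
  have k1 : X * b * (C * G) = C * G * (X * b) := by
    calc X * b * (C * G) = X * (b * C) * G := by noncomm_ring
      _ = X * (C * T * b) * G := by rw [hCTb]
      _ = X * C * T * (b * G) := by noncomm_ring
      _ = (X * C) * T * (G * b) := by rw [hbG.eq]
      _ = C * X * (T * G) * b := by rw [← hCX.eq]; noncomm_ring
      _ = C * (X * (G * T)) * b := by rw [hTG.eq]; noncomm_ring
      _ = _ := by rw [← hGX]; noncomm_ring
  have hA := hX
  have hB : Obs (X * b) := hX.mul hb hbX.eq.symm
  have hD : Obs (C * G) := hC.mul hG hCG.eq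
  have hAC : Obs (X * C) := hX.mul hC hCX.eq.symm
  have hBD : Obs (X * b * (C * G)) := hB.mul hD k1
  have hF : Obs (b * G) := hb.mul hG hbG.eq
  have hE' : X * C * (X * b * (C * G)) = T * b * G := by
    calc X * C * (X * b * (C * G)) = X * (C * X) * b * (C * G) := by noncomm_ring
      _ = (X * X) * C * b * (C * G) := by rw [hCX.eq]; noncomm_ring
      _ = C * b * C * G := by rw [hX.2]; noncomm_ring
      _ = C * b * C * (b * b) * G := by rw [hb.2, mul_one]
      _ = (C * (b * C * b)) * b * G := by noncomm_ring
      _ = _ := by rw [← hTd]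
  have k2 : X * C * (X * b * (C * G)) = X * b * (C * G) * (X * C) := by
    have h1 : X * b * (C * G) * (X * C) = b * (G * T) := by
      calc X * b * (C * G) * (X * C) = X * b * C * (G * X) * C := by noncomm_ring
        _ = X * b * (C * X) * (G * T) * C := by rw [hGX]; noncomm_ring
        _ = X * (b * X) * C * (G * T) * C := by rw [hCX.eq]; noncomm_ring
        _ = (X * X) * b * (C * (G * T)) * C := by rw [hbX.eq]; noncomm_ring
        _ = b * (G * T) * (C * C) := by
          rw [(hCG.mul_right hTC).eq, hX.2]; noncomm_ring
        _ = _ := by rw [hC.2, mul_one]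
    rw [hE', h1, ← hTG.eq, ← mul_assoc, hbT.eq]
  have hE : Obs (T * b * G) := by rw [← hE']; exact hAC.mul hBD k2
  have hEF : T * b * G * (b * G) = T := by
    calc T * b * G * (b * G) = T * (b * (G * b) * G) := by noncomm_ring
      _ = T * ((b * b) * (G * G)) := by rw [← hbG.eq]; noncomm_ring
      _ = T := by rw [hb.2, hG.2, mul_one, mul_one]
  have hFE : b * G * (T * b * G) = T := by
    have h : T * b * G = b * G * T := by rw [← hbT.eq, mul_assoc, hTG.eq, mul_assoc]
    rw [h, ← mul_assoc, hF.2, one_mul]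
  refine ⟨fun l => match l with
    | .A => X | .B => X * b | .D => C * G | .CD => G | .AC => X * C | .BD => X * b * (C * G)
    | .E => T * b * G | .F => b * G | .T => T, ?_, ?_, ?_⟩
  · intro l
    cases l <;> assumption
  · refine ⟨hbX.eq.symm, ?_, k2, hCX.eq.symm, k1, hbG.eq, ?_, hTC.eq⟩
    · exact ((Commute.refl C).mul_right hCG).eq
    · exact hEF.trans hFE.symm
  · refine ⟨rfl, ?_, hE'.symm, rfl, rfl, rfl, hEF.symm, hCT.symm⟩
    show G = C * (C * G)
    rw [← mul_assoc, hC.2, one_mul]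

end


/-! ### Approximate model: monomial matrices -/

section

variable {κ : Type} [Fintype κ] [DecidableEq κ]

/-- Monomial matrices. -/
def Mn {ι : Type} [DecidableEq ι] (f : ι → ι) (c : ι → ℂ) : Matrix ι ι ℂ :=
  Matrix.of fun i j => if i = f j then c j else 0

theorem Mn_mul {ι : Type} [Fintype ι] [DecidableEq ι] (f g : ι → ι) (c d : ι → ℂ) :
    Mn f c * Mn g d = Mn (fun i => f (g i)) (fun i => c (g i) * d i) := by
  ext i j
  simp [Mn, Matrix.mul_apply]

theorem Mn_one {ι : Type} [DecidableEq ι] : (1 : Matrix ι ι ℂ) = Mn id (fun _ => 1) := by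
  ext i j
  simp [Mn, Matrix.one_apply]

theorem Mn_obs {ι : Type} [Fintype ι] [DecidableEq ι] (f : ι → ι) (c : ι → ℂ)
    (hf : ∀ i, f (f i) = i) (h1 : ∀ i, c (f i) * c i = 1) (h2 : ∀ i, star (c (f i)) = c i) :
    Obs (Mn f c) := by
  refine ⟨?_, ?_⟩
  · ext i j
    simp only [Matrix.conjTranspose_apply, Mn, Matrix.of_apply]
    by_cases h : j = f i
    · subst h
      simpa [hf] using (congrArg star (h2 i)).symm
    · have h' : i ≠ f j := by
        rintro rfl
        exact h (hf j).symm
      simp [h, h']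
  · rw [Mn_mul, Mn_one]
    congr 1
    · funext i; exact hf i
    · funext i; exact h1 i

/-- Monomial matrices with an idle ancilla. -/
def Kn (f : κ → κ) (c : κ → ℂ) : Matrix (κ × Bool) (κ × Bool) ℂ :=
  Mn (fun p => (f p.1, p.2)) (fun p => c p.1)

theorem Kn_mul (f g : κ → κ) (c d : κ → ℂ) :
    Kn f c * Kn g d = Kn (fun i => f (g i)) (fun i => c (g i) * d i) := by
  simp [Kn, Mn_mul]

theorem Kn_obs (f : κ → κ) (c : κ → ℂ)
    (hf : ∀ i, f (f i) = i) (h1 : ∀ i, c (f i) * c i = 1) (h2 : ∀ i, star (c (f i)) = c i) :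
    Obs (Kn f c) := 
  Mn_obs _ _ (by simp [hf]) (fun p => h1 p.1) (fun p => h2 p.1)

/-- Ancilla flip. -/
def Xan : Matrix (κ × Bool) (κ × Bool) ℂ := Mn (fun p => (p.1, !p.2)) (fun _ => 1)
/-- Ancilla phase. -/
def Zan : Matrix (κ × Bool) (κ × Bool) ℂ := Mn (fun p => p) (fun p => if p.2 then 1 else -1)

theorem Xan_obs : Obs (Xan (κ := κ)) := Mn_obs _ _ (by simp) (by simp) (by simp)

theorem Zan_obs : Obs (Zan (κ := κ)) := by
  refine Mn_obs _ _ (by simp) ?_ ?_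
  · rintro ⟨p, _ | _⟩ <;> simp
  · rintro ⟨p, _ | _⟩ <;> simp

theorem Kn_X (f : κ → κ) (c : κ → ℂ) : Commute (Kn f c) Xan := by
  show Kn f c * Xan = Xan * Kn f c
  simp [Kn, Xan, Mn_mul]

theorem Kn_Z (f : κ → κ) (c : κ → ℂ) : Commute (Kn f c) Zan := by
  show Kn f c * Zan = Zan * Kn f c
  simp [Kn, Zan, Mn_mul, mul_comm]

theorem Xan_Zan : Xan (κ := κ) * Zan = -(Zan * Xan) := by
  rw [Xan, Zan, Mn_mul, Mn_mul]
  ext i ⟨p, r⟩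
  simp only [Mn, Matrix.of_apply, Matrix.neg_apply]
  cases r <;> simp <;> split_ifs <;> simp

open scoped Matrix.Norms.L2Operator in
theorem Kn_sub_norm (f : κ → κ) (c d : κ → ℂ) (hf : ∀ i, f (f i) = i) (ε : ℝ) (hε : 0 ≤ ε)
    (h : ∀ i, ‖c i - d i‖ ≤ ε) : ‖Kn f c - Kn f d‖ ≤ ε := by
  have h1 : Kn f c - Kn f d = Kn f (fun _ => 1) *
      Matrix.diagonal (fun p : κ × Bool => c p.1 - d p.1) := by
    ext i j
    simp only [Kn, Mn, Matrix.sub_apply, Matrix.of_apply, Matrix.mul_diagonal]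
    split_ifs <;> simp
  have hO : Obs (Kn f (fun _ => 1)) := Kn_obs _ _ hf (by simp) (by simp)
  have h2 : ‖Kn f (fun _ => (1 : ℂ))‖ ≤ 1 := by
    have h3 : ‖Kn f (fun _ => (1 : ℂ))‖ * ‖Kn f (fun _ => (1 : ℂ))‖ ≤ 1 := by
      have h4 := CStarRing.norm_star_mul_self (x := Kn f (fun _ => (1 : ℂ)))
      have h5 : star (Kn f (fun _ => (1 : ℂ))) = Kn f (fun _ => (1 : ℂ)) := hO.1
      rw [← h4, h5, hO.2, ← Matrix.diagonal_one, Matrix.l2_opNorm_diagonal]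
      exact (pi_norm_le_iff_of_nonneg zero_le_one).2 (by simp)
    nlinarith [norm_nonneg (Kn f (fun _ => (1 : ℂ)))]
  have h3 : ‖Matrix.diagonal (fun p : κ × Bool => c p.1 - d p.1)‖ ≤ ε := by
    rw [Matrix.l2_opNorm_diagonal]
    exact (pi_norm_le_iff_of_nonneg hε).2 (fun p => h p.1)
  rw [h1]
  refine (norm_mul_le _ _).trans ?_
  nlinarith [norm_nonneg (Matrix.diagonal (fun p : κ × Bool => c p.1 - d p.1))]

end

/-- Combinatorial data of the approximate model. -/
structure Mdl (ι : Type) (ε : ℝ) where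
  neg : ι → ι
  sh : ι → ι
  k : ι → ι
  x : ι → ι
  lam : ι → ℂ
  neg_neg : ∀ i, neg (neg i) = i
  sh_sh : ∀ i, sh (sh i) = i
  neg_sh : ∀ i, neg (sh i) = sh (neg i)
  xk : ∀ i, x (k i) = i
  kx : ∀ i, k (x i) = i
  k_neg : ∀ i, k (neg i) = neg (k i)
  lam_neg : ∀ i, lam (neg i) = star (lam i)
  lam_mul : ∀ i, lam (neg i) * lam i = 1
  lam_sh : ∀ i, lam (sh i) = - lam i
  close : ∀ i, ‖lam i * lam i - lam (k i)‖ ≤ ε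

theorem Mdl.x_neg {ι : Type} {ε : ℝ} (D : Mdl ι ε) (i : ι) : D.x (D.neg i) = D.neg (D.x i) := by
  have := congrArg D.x (D.k_neg (D.x i))
  rw [D.xk, D.kx] at this
  exact this.symm

/-- Underlying permutations of the main variables. -/
def Mdl.f {ι : Type} {ε : ℝ} (D : Mdl ι ε) : MainV → ι × ι → ι × ι
  | .U, p => (D.neg p.1, p.2)
  | .V, p => (D.neg p.1, p.2)
  | .U2, p => (p.1, D.neg p.2)
  | .V2, p => (p.1, D.neg p.2)
  | .B1, p => (p.2, p.1)
  | .B2, p => (D.x p.2, D.k p.1)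
  | .B3, p => (D.neg p.2, D.neg p.1)
  | .P, p => (D.neg p.1, D.neg p.2)
  | .W1, p => (D.neg p.1, p.2)
  | .W2, p => (D.neg p.1, p.2)
  | .a1, p => p
  | .a2, p => (D.sh p.1, p.2)
  | .Vb, p => (D.neg p.1, p.2)
  | .c1, p => (D.neg p.1, D.neg p.2)
  | .c2, p => (D.neg p.1, p.2)
  | .c3, p => (D.neg (D.sh p.1), p.2)

/-- Coefficients of the main variables. -/
def Mdl.c {ι : Type} {ε : ℝ} (D : Mdl ι ε) : MainV → ι × ι → ℂ
  | .U, _ => 1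
  | .V, p => D.lam p.1
  | .U2, _ => 1
  | .V2, p => D.lam p.2
  | .B1, _ => 1
  | .B2, _ => 1
  | .B3, p => D.lam p.2 * D.lam p.1
  | .P, p => D.lam p.1 * D.lam p.2
  | .W1, p => D.lam p.1 * D.lam p.1
  | .W2, p => D.lam (D.k p.1)
  | .a1, _ => 1
  | .a2, _ => 1
  | .Vb, p => D.lam p.1
  | .c1, p => D.lam p.2
  | .c2, _ => 1
  | .c3, _ => 1

theorem Mdl.mul_lam {ι : Type} {ε : ℝ} (D : Mdl ι ε) (i : ι) :
    D.lam i * D.lam (D.neg i) = 1 := by rw [mul_comm, D.lam_mul]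

/-- The main operators. -/
def Mdl.M {ι : Type} [Fintype ι] [DecidableEq ι] {ε : ℝ} (D : Mdl ι ε) (v : MainV) :
    Matrix ((ι × ι) × Bool) ((ι × ι) × Bool) ℂ := Kn (D.f v) (D.c v)

section

variable {ι : Type} [Fintype ι] [DecidableEq ι] {ε : ℝ} (D : Mdl ι ε)

theorem Mdl.M_obs (v : MainV) : Obs (D.M v) := by
  have hs : ∀ i, star (D.lam (D.neg i)) = D.lam i := fun i => by
    rw [D.lam_neg, star_star]
  have key : ∀ a b : ι, D.lam (D.neg a) * D.lam (D.neg b) * (D.lam b * D.lam a) = 1 := by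
    intro a b
    linear_combination (D.lam (D.neg b) * D.lam b) * D.lam_mul a + D.lam_mul b
  apply Kn_obs
  · rintro ⟨i, j⟩
    cases v <;> simp [Mdl.f, D.neg_neg, D.sh_sh, D.xk, D.kx, D.neg_sh]
  · rintro ⟨i, j⟩
    cases v <;> simp [Mdl.f, Mdl.c, D.lam_mul, D.k_neg]
    · exact key i j
    · rw [mul_comm (D.lam i)]; exact key i j
    · exact key i i
  · rintro ⟨i, j⟩
    cases v <;> simp only [Mdl.f, Mdl.c, hs, D.k_neg, star_mul, star_one]
    exact mul_comm _ _

theorem Mdl.main_eq (k : Fin 5) : ∃ u v w, mainS k 0 = .m u ∧ mainS k 1 = .m v ∧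
    mainS k 2 = .m w ∧ D.M u * D.M v = D.M v * D.M u ∧ D.M w = D.M u * D.M v := by
  fin_cases k <;> refine ⟨_, _, _, rfl, rfl, rfl, ?_, ?_⟩ <;> simp only [Mdl.M, Kn_mul] <;>
    congr 1 <;> funext ⟨i, j⟩ <;>
    simp [Mdl.f, Mdl.c, D.neg_sh, mul_comm, D.lam_mul, D.mul_lam]

theorem Kn_smul {κ : Type} [DecidableEq κ] (f : κ → κ) (c : κ → ℂ) (z : ℂ) :
    z • Kn f c = Kn f (fun i => z * c i) := by
  ext i j
  simp [Kn, Mn]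

theorem Mdl.gad_eq (g : Fin 7) :
    D.M (gZ g) = (((gS g : ℤˣ) : ℤ) : ℂ) • (D.M (gB g) * D.M (gC g) * D.M (gB g)) := by
  have key : ∀ i j, D.lam i * D.lam i = D.lam i * D.lam (D.neg j) * (D.lam j * D.lam i) := by
    intro i j
    linear_combination (-(D.lam i * D.lam i)) * D.lam_mul j
  have k2 : ∀ i, D.neg i = D.sh (D.neg (D.sh i)) := by
    intro i
    rw [D.neg_sh, D.sh_sh]
  simp only [Mdl.M, Kn_mul, Kn_smul]
  congr 1
  · funext ⟨i, j⟩
    fin_cases g <;> simp [gZ, gB, gC, Mdl.f, D.neg_neg, D.xk, D.kx, D.k_neg, D.x_neg, D.neg_sh,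
      D.sh_sh]
  · funext ⟨i, j⟩
    fin_cases g <;> simp [gZ, gB, gC, gS, Mdl.f, Mdl.c, D.lam_sh, D.neg_neg]
    exact key i j

theorem Mdl.gad_comm (g : Fin 7) : Commute (D.M (gC g)) (D.M (gZ g)) := by
  show D.M (gC g) * D.M (gZ g) = D.M (gZ g) * D.M (gC g)
  simp only [Mdl.M, Kn_mul]
  congr 1
  · funext ⟨i, j⟩
    fin_cases g <;> simp [gZ, gC, Mdl.f]
  · funext ⟨i, j⟩
    fin_cases g <;> simp [gZ, gC, Mdl.f, Mdl.c, mul_comm]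

open scoped Matrix.Norms.L2Operator in
theorem Mdl.W_close (hε : 0 ≤ ε) : ‖D.M .W1 - D.M .W2‖ ≤ ε :=
  Kn_sub_norm _ _ _ (fun i => by simp [Mdl.f, D.neg_neg]) ε hε (fun i => D.close i.1)

open scoped Matrix.Norms.L2Operator in
theorem Mdl.solution {ι : Type} [Fintype ι] [DecidableEq ι] {ε : ℝ} (D : Mdl ι ε) (hε : 0 ≤ ε) : ∃ X : AllV → Matrix ((ι × ι) × Bool) ((ι × ι) × Bool) ℂ,
    (∀ v, (X v).IsHermitian ∧ X v * X v = 1) ∧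
        (∀ k, X (sysS k 0) * X (sysS k 1) = X (sysS k 1) * X (sysS k 0)) ∧
        (∀ k, X (sysS k 2) = ((sysB k : ℤ) : ℂ) • (X (sysS k 0) * X (sysS k 1))) ∧
        ∀ v w, qV v = qV w → ‖X v - X w‖ ≤ ε := by
  have hcc : ∀ g, Commute (D.M (gC g)) (D.M (gB g) * D.M (gC g) * D.M (gB g)) := by
    intro g
    have h1 := D.gad_eq g
    have h2 : D.M (gB g) * D.M (gC g) * D.M (gB g) = (((gS g : ℤˣ) : ℤ) : ℂ) • D.M (gZ g) := by
      rw [h1, smul_smul, units_sq_C, one_smul]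
    rw [h2]
    exact (D.gad_comm g).smul_right _
  have hg := fun g => gadget_model (D.M (gB g)) (D.M (gC g)) Xan Zan (D.M_obs _) (D.M_obs _)
    Xan_obs Zan_obs (Kn_X _ _) (Kn_Z _ _) (Kn_X _ _) (Kn_Z _ _) Xan_Zan (hcc g)
  choose L hL1 hL2 hL3 using hg
  refine ⟨fun v => match v with
    | .m u => D.M u
    | .g k l => L k l, ?_, ?_, ?_, ?_⟩
  · rintro (u | ⟨k, l⟩)
    · exact D.M_obs u
    · exact hL1 k l
  · rintro (k | ⟨g, k⟩)
    · obtain ⟨u, v, w, e1, e2, e3, e4, e5⟩ := D.main_eq k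
      simp only [sysS, e1, e2, e4]
    · obtain ⟨h0, h1, h2, h3, h4, h5, h6, h7⟩ := hL2 g
      fin_cases k
      exacts [h0, h1, h2, h3, h4, h5, h6, h7]
  · rintro (k | ⟨g, k⟩)
    · obtain ⟨u, v, w, e1, e2, e3, e4, e5⟩ := D.main_eq k
      simp only [sysS, sysB, e1, e2, e3, e5]
      simp
    · obtain ⟨h0, h1, h2, h3, h4, h5, h6, h7⟩ := hL3 g
      have o : ∀ N : Matrix ((ι × ι) × Bool) ((ι × ι) × Bool) ℂ,
          (((1 : ℤˣ) : ℤ) : ℂ) • N = N := by simp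
      have h8 := D.gad_eq g
      rw [h7] at h8
      fin_cases k
      exacts [h0.trans (o _).symm, h1.trans (o _).symm, h2.trans (o _).symm, h3.trans (o _).symm,
        h4.trans (o _).symm, h5.trans (o _).symm, h6.trans (o _).symm, h8]
  · intro v w hvw
    have h12 := D.W_close hε
    have h21 : ‖D.M .W2 - D.M .W1‖ ≤ ε := by rw [norm_sub_rev]; exact h12
    by_cases h : v = w
    · subst h; simpa using hε
    · rcases v with u | ⟨k, l⟩ <;> rcases w with u' | ⟨k', l'⟩
      · cases u <;> cases u' <;> simp [qV] at hvw h ⊢ <;> assumption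
      · cases u <;> simp [qV] at hvw
      · cases u' <;> simp [qV] at hvw
      · simp [qV] at hvw h
        exact absurd hvw.2 (h hvw.1)

end


/-! ### Approximate model: concrete data -/

/-- Index set. -/
abbrev IX (K : ℕ) : Type := Bool × Bool × Fin K

/-- Sign attached to a Boolean. -/
def bsg (s : Bool) : ℝ := if s then -1 else 1

/-- Angles. -/
def ang (K : ℕ) (p : IX K) : ℝ :=
  bsg p.1 * (Real.pi * (p.2.2.1 + 1 / 2) / (2 * K) + if p.2.1 then Real.pi else 0)

/-- Phases. -/
def ph (t : ℝ) : ℂ := Complex.exp (Complex.I * t)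

theorem ph_add (s t : ℝ) : ph (s + t) = ph s * ph t := by
  simp [ph, mul_add, Complex.exp_add]

theorem ph_zero : ph 0 = 1 := by simp [ph]

theorem ph_pi : ph Real.pi = -1 := by
  rw [ph, mul_comm]; exact Complex.exp_pi_mul_I

theorem ph_neg_pi : ph (-Real.pi) = -1 := by
  have h := ph_add Real.pi (-Real.pi)
  rw [add_neg_cancel, ph_zero, ph_pi] at h
  linear_combination h

theorem ph_neg (t : ℝ) : ph (-t) = star (ph t) := by
  rw [ph, ph, Complex.star_def, ← Complex.exp_conj]
  simp

theorem ph_norm (t : ℝ) : ‖ph t‖ = 1 := by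
  rw [ph, mul_comm]; exact Complex.norm_exp_ofReal_mul_I t

theorem ph_dist (s t : ℝ) : ‖ph s - ph t‖ ≤ |s - t| := by
  have h : ph s - ph t = ph t * (ph (s - t) - 1) := by
    rw [mul_sub, ← ph_add, mul_one]
    congr 2; ring
  rw [h, norm_mul, ph_norm, one_mul]
  exact Real.norm_exp_I_mul_ofReal_sub_one_le

/-- The doubling permutation. -/
def kp (K : ℕ) (p : IX K) : IX K :=
  if h : 2 * p.2.2.1 + p.2.1.toNat < K then (p.1, false, ⟨2 * p.2.2.1 + p.2.1.toNat, h⟩)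
  else (!p.1, true, ⟨2 * K - 1 - (2 * p.2.2.1 + p.2.1.toNat), by
    have := p.2.2.2; omega⟩)

theorem kp_inj (K : ℕ) : Function.Injective (kp K) := by
  rintro ⟨s, t, j, hj⟩ ⟨s', t', j', hj'⟩ h
  have ht := Bool.toNat_le t
  have ht' := Bool.toNat_le t'
  simp only [kp] at h
  have tinj : t.toNat = t'.toNat → t = t' := by cases t <;> cases t' <;> simp
  split_ifs at h with h1 h2 h2
  · simp only [Prod.mk.injEq, Fin.mk.injEq] at h ⊢
    exact ⟨h.1, tinj (by omega), by omega⟩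
  · simp at h
  · simp at h
  · simp only [Prod.mk.injEq, Fin.mk.injEq, Bool.not_inj_iff] at h ⊢
    exact ⟨h.1, tinj (by omega), by omega⟩

theorem ang_kp (K : ℕ) (hK : 0 < K) (p : IX K) :
    ‖ph (ang K p) * ph (ang K p) - ph (ang K (kp K p))‖ ≤ Real.pi / (4 * K) := by
  obtain ⟨s, t, j⟩ := p
  have hK' : (0 : ℝ) < K := by exact_mod_cast hK
  have hpi := Real.pi_pos
  -- reduce both sides to standard angles
  have e0 : ph (2 * Real.pi) = 1 := by
    rw [two_mul, ph_add, ph_pi]; norm_num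
  have e0' : ph (-(2 * Real.pi)) = 1 := by
    rw [ph_neg, e0]; simp
  have es : ∀ s, ph (bsg s * (2 * Real.pi)) = 1 := by
    intro s; cases s <;> simp [bsg, e0, e0']
  have e1 : ph (ang K (s, t, j)) * ph (ang K (s, t, j)) =
      ph (bsg s * (Real.pi * (2 * j.1 + 1) / (2 * K))) := by
    rw [← ph_add]
    cases t
    · congr 1; simp only [ang]; field_simp; simp; ring
    · have : ang K (s, true, j) + ang K (s, true, j) =
          bsg s * (Real.pi * (2 * j.1 + 1) / (2 * K)) + bsg s * (2 * Real.pi) := by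
        simp only [ang, if_true]; field_simp; ring
      rw [this, ph_add, es, mul_one]
  have e2 : ph (ang K (kp K (s, t, j))) =
      ph (bsg s * (Real.pi * (2 * j.1 + t.toNat + 1 / 2) / (2 * K))) := by
    by_cases h : 2 * j.1 + t.toNat < K
    · simp only [kp, dif_pos h]
      congr 1
      simp [ang]
    · simp only [kp, dif_neg h]
      have hj := j.2
      have ht := Bool.toNat_le t
      have hc : ((2 * K - 1 - (2 * j.1 + t.toNat) : ℕ) : ℝ) = 2 * K - 1 - (2 * j.1 + t.toNat) := by
        rw [Nat.cast_sub (by omega), Nat.cast_sub (by omega)]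
        push_cast; ring
      have hb : bsg (!s) = - bsg s := by cases s <;> simp [bsg]
      have : bsg s * (Real.pi * (2 * j.1 + t.toNat + 1 / 2) / (2 * K)) =
          ang K (!s, true, ⟨2 * K - 1 - (2 * j.1 + t.toNat), by omega⟩) +
            bsg s * (2 * Real.pi) := by
        simp only [ang, if_true, hc, hb]
        field_simp; ring
      rw [this, ph_add, es, mul_one]
  rw [e1, e2]
  refine (ph_dist _ _).trans ?_
  have hd : bsg s * (Real.pi * (2 * j.1 + 1) / (2 * K)) -
      bsg s * (Real.pi * (2 * j.1 + t.toNat + 1 / 2) / (2 * K)) =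
      bsg s * ((1 - 2 * t.toNat) * (Real.pi / (4 * K))) := by
    field_simp; ring
  have hp : 0 < Real.pi / (4 * K) := by positivity
  have hb : |bsg s| = 1 := by cases s <;> simp [bsg]
  have hb2 : |(1 : ℝ) - 2 * t.toNat| = 1 := by cases t <;> norm_num
  rw [hd, abs_mul, abs_mul, hb, hb2, abs_of_pos hp, one_mul, one_mul]

theorem exists_mdl (K : ℕ) (hK : 0 < K) : Nonempty (Mdl (IX K) (Real.pi / (4 * K))) := by
  have hbij : Function.Bijective (kp K) := Finite.injective_iff_bijective.1 (kp_inj K)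
  let e := Equiv.ofBijective _ hbij
  have hneg : ∀ p : IX K, ang K (!p.1, p.2) = - ang K p := by
    rintro ⟨s, t, j⟩
    cases s <;> simp [ang, bsg] <;> ring
  refine ⟨{
    neg := fun p => (!p.1, p.2)
    sh := fun p => (p.1, !p.2.1, p.2.2)
    k := kp K
    x := e.symm
    lam := fun p => ph (ang K p)
    neg_neg := by simp
    sh_sh := by simp
    neg_sh := by simp
    xk := fun i => e.symm_apply_apply i
    kx := fun i => e.apply_symm_apply i
    k_neg := ?_
    lam_neg := ?_
    lam_mul := ?_
    lam_sh := ?_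
    close := ang_kp K hK }⟩
  · rintro ⟨s, t, j⟩
    simp only [kp]
    split_ifs <;> rfl
  · intro i; rw [hneg, ph_neg]
  · intro i; rw [hneg, ← ph_add, neg_add_cancel, ph_zero]
  · rintro ⟨s, t, j⟩
    have h1 : ang K (s, true, j) = ang K (s, false, j) + bsg s * Real.pi := by
      simp [ang]; ring
    have h2 : ph (ang K (s, true, j)) = - ph (ang K (s, false, j)) := by
      rw [h1, ph_add]
      cases s <;> simp [bsg, ph_pi, ph_neg_pi]
    cases t <;> simp [h2]

theorem qaiso_main : QAIso (SG (fun k i => qV (sysS k i)) sys_inj (fun _ => 1))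
    (SG (fun k i => qV (sysS k i)) sys_inj sysB) := by
  apply qaiso_of_approx sysS qV
  intro ε hε
  obtain ⟨n, hn⟩ := exists_nat_gt (Real.pi / (4 * ε))
  have hn0 : (0 : ℝ) < n := lt_trans (by positivity) hn
  have hn' : 0 < n := by exact_mod_cast hn0
  obtain ⟨D⟩ := exists_mdl n hn'
  obtain ⟨X, h1, h2, h3, h4⟩ := D.solution (by positivity)
  have : NeZero n := ⟨hn'.ne'⟩
  refine ⟨(IX n × IX n) × Bool, inferInstance, inferInstance, inferInstance, X, h1, h2, h3, ?_⟩
  intro v w hvw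
  refine (h4 v w hvw).trans ?_
  rw [div_lt_iff₀ (by positivity)] at hn
  rw [div_le_iff₀ (by positivity)]
  linarith

/-- There are finite graphs `G`, `H` with `G ≅_qa H` but not `G ≅_q H`. -/
theorem exists_graphs_QAIso_not_QIso :
    ∃ (VG VH : Type) (_instG : Fintype VG) (_instH : Fintype VH)
      (G : SimpleGraph VG) (H : SimpleGraph VH),
      @QAIso VG VH _instG _instH G H ∧ ¬ @QIso VG VH _instG _instH G H := by
  exact ⟨_, _, inferInstance, inferInstance, _, _, qaiso_main, not_qiso⟩
end
end

section
/- For all integers n, m ≥ 1, if C_q(n,m) is a closed subset of ℝ^{n²m²} then C_q^s(n,m) is closed; consequently (combined with the non-closedness of C_q^s(m, 2^n) for suitable m, n) there exist integers m, n ≥ 1 such that C_q(m, 2^n) is not a closed subset of ℝ^{m²(2^n)²}. -/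
open Matrix

noncomputable section

/-- A correlation is synchronous if `p(a,b|x,x) = 0` whenever `a ≠ b`. -/
def Synchronous {I O : Type} (p : I → I → O → O → ℝ) : Prop :=
  ∀ x a b, a ≠ b → p x x a b = 0


/-- combinatorial data -/
lemma comb (n c : ℕ) (hc : c < n + 1) :
    ∃ (σ τ : Fin (n+1) → Fin (n+1)) (a b : Fin (n+1) → ℝ) (k : Fin (n+1) → ℝ),
      (∀ i, σ (σ i) = i) ∧ (∀ i, τ (τ i) = i) ∧
      (∀ i, a (σ i) = 1 - a i) ∧ (∀ i, b (τ i) = 1 - b i) ∧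
      (∀ i, 0 ≤ a i ∧ a i ≤ 1) ∧ (∀ i, 0 ≤ b i ∧ b i ≤ 1) ∧
      (∀ i, k i * k i = k i) ∧
      (∀ i, 2 * a i + 2 * b i + 2 * k i = 2 + 2 * ((c : ℝ) / ((n + 1 : ℕ) : ℝ))) := by
  let f : ZMod (n+1) → ℝ := fun j => ((j.val : ℝ) + 1/2) / ((n + 1 : ℕ) : ℝ)
  have hd : (0:ℝ) < ((n + 1 : ℕ) : ℝ) := by positivity
  have hf : ∀ j, f (-1 - j) = 1 - f j := by
    intro j
    have h1 : ((-1 - j : ZMod (n+1)).val + j.val : ℕ) = n := by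
      have h2 : (-1 - j) + j = (-1 : ZMod (n+1)) := by ring
      have h3 := congrArg ZMod.val h2
      rw [ZMod.val_neg_one] at h3
      rcases lt_or_ge ((-1 - j : ZMod (n+1)).val + j.val) (n+1) with h | h
      · rw [ZMod.val_add_of_lt h] at h3; exact h3
      · have := ZMod.val_add_val_of_le h
        have := ZMod.val_lt (-1 - j : ZMod (n+1))
        have := ZMod.val_lt j
        omega
    have h4 : ((-1 - j : ZMod (n+1)).val : ℝ) + j.val = n := by exact_mod_cast h1
    simp only [f]
    rw [eq_sub_iff_add_eq, ← add_div, div_eq_one_iff_eq hd.ne']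
    push_cast; linarith
  have hf01 : ∀ j, 0 ≤ f j ∧ f j ≤ 1 := by
    intro j
    have hj : j.val + 1 ≤ n + 1 := ZMod.val_lt j
    have hj' : (j.val : ℝ) + 1 ≤ ((n + 1 : ℕ) : ℝ) := by exact_mod_cast hj
    refine ⟨by positivity, ?_⟩
    simp only [f]
    rw [div_le_one hd]; linarith
  have hcv : ((c : ZMod (n+1))).val = c := ZMod.val_cast_of_lt hc
  have hk : ∀ j : ZMod (n+1), ∃ k : ℝ, k * k = k ∧
      2 * f j + 2 * (1 - f (j - c)) + 2 * k = 2 + 2 * ((c : ℝ) / ((n + 1 : ℕ) : ℝ)) := by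
    intro j
    have e : j - c + c = j := by ring
    have e' := congrArg ZMod.val e
    rcases lt_or_ge ((j - c : ZMod (n+1)).val + (c : ZMod (n+1)).val) (n+1) with h | h
    · rw [ZMod.val_add_of_lt h, hcv] at e'
      refine ⟨0, by norm_num, ?_⟩
      simp only [f]
      rw [← e']; push_cast; field_simp; ring
    · have h' := ZMod.val_add_val_of_le h
      rw [e, hcv] at h'
      refine ⟨1, by norm_num, ?_⟩
      have h'' : ((j - c : ZMod (n+1)).val : ℝ) + c = j.val + ((n+1 : ℕ) : ℝ) := by exact_mod_cast h'
      have h3 : ((j - c : ZMod (n+1)).val : ℝ) = j.val + ((n+1 : ℕ) : ℝ) - c := by linarith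
      simp only [f]
      rw [h3]; push_cast; field_simp; ring
  choose k hk1 hk2 using hk
  let g : ZMod (n+1) → ℝ := fun j => 1 - f (j - c)
  let τ : ZMod (n+1) → ZMod (n+1) := fun j => 2 * c - 1 - j
  let σ : ZMod (n+1) → ZMod (n+1) := fun j => -1 - j
  have hσ : ∀ i, σ (σ i) = i := by intro i; simp only [σ]; ring
  have hτ : ∀ i, τ (τ i) = i := by intro i; simp only [τ]; ring
  have hg : ∀ i, g (τ i) = 1 - g i := by
    intro i
    simp only [g, τ]
    have : (2 * c - 1 - i - c : ZMod (n+1)) = -1 - (i - c) := by ring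
    rw [this, hf]
  have hg01 : ∀ i, 0 ≤ g i ∧ g i ≤ 1 := by
    intro i
    have := hf01 (i - c)
    constructor <;> simp only [g] <;> linarith
  exact ⟨σ, τ, f, g, k, hσ, hτ, hf, hg, hf01, hg01, hk1, hk2⟩

/-- the projection `D_a + ε D_b W` -/
def pj {d : ℕ} (σ : Fin d → Fin d) (a : Fin d → ℝ) (ε : ℝ) : Matrix (Fin d) (Fin d) ℝ :=
  Matrix.of fun i j => (if j = i then a i else 0) + (if j = σ i then ε * √(a i * (1 - a i)) else 0)

lemma pj_symm {d : ℕ} (σ : Fin d → Fin d) (a : Fin d → ℝ) (ε : ℝ)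
    (hσ : ∀ i, σ (σ i) = i) (ha : ∀ i, a (σ i) = 1 - a i) : (pj σ a ε)ᵀ = pj σ a ε := by
  ext i j
  simp only [pj, transpose_apply, of_apply]
  congr 1
  · by_cases h : i = j
    · subst h; rfl
    · rw [if_neg h, if_neg (Ne.symm h)]
  · by_cases h : i = σ j
    · subst h
      rw [if_pos rfl, if_pos (hσ j).symm, ha]; ring_nf
    · rw [if_neg h, if_neg]
      rintro rfl; exact h (hσ i).symm

lemma pj_idem {d : ℕ} (σ : Fin d → Fin d) (a : Fin d → ℝ) (ε : ℝ) (hε : ε * ε = 1)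
    (hσ : ∀ i, σ (σ i) = i) (ha : ∀ i, a (σ i) = 1 - a i) (h01 : ∀ i, 0 ≤ a i ∧ a i ≤ 1) :
    pj σ a ε * pj σ a ε = pj σ a ε := by
  ext i j
  rw [Matrix.mul_apply]
  have : ∀ k, pj σ a ε i k * pj σ a ε k j =
      (if k = i then a i * pj σ a ε k j else 0) +
      (if k = σ i then ε * √(a i * (1 - a i)) * pj σ a ε k j else 0) := by
    intro k; conv_lhs => rw [pj, of_apply]
    simp only [add_mul, ite_mul, zero_mul]
    rfl
  simp only [this, Finset.sum_add_distrib, Finset.sum_ite_eq', Finset.mem_univ, if_true]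
  have hs : √(a i * (1 - a i)) * √(a i * (1 - a i)) = a i * (1 - a i) :=
    Real.mul_self_sqrt (mul_nonneg (h01 i).1 (by linarith [(h01 i).2]))
  have hs' : √(a (σ i) * (1 - a (σ i))) = √(a i * (1 - a i)) := by rw [ha]; ring_nf
  simp only [pj, of_apply, hσ, hs']
  simp only [ha]
  set r := √(a i * (1 - a i))
  split_ifs
  · linear_combination (ε * ε) * hs + a i * (1 - a i) * hε
  · linear_combination (ε * ε) * hs + a i * (1 - a i) * hε
  · ring
  · ring

lemma projs (n c : ℕ) (hc : c < n + 1) :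
    ∃ P : Fin 6 → Matrix (Fin (n+1)) (Fin (n+1)) ℝ, (∀ x, (P x)ᵀ = P x) ∧
      (∀ x, P x * P x = P x) ∧
      ∑ x, P x = (2 + 2 * ((c : ℝ) / ((n + 1 : ℕ) : ℝ))) • (1 : Matrix _ _ ℝ) := by
  obtain ⟨σ, τ, a, b, k, hσ, hτ, ha, hb, ha1, hb1, hk, hs⟩ := comb n c hc
  have hd : (diagonal k : Matrix (Fin (n+1)) (Fin (n+1)) ℝ) * diagonal k = diagonal k := by
    rw [diagonal_mul_diagonal]; congr 1; ext i; exact hk i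
  refine ⟨![pj σ a 1, pj σ a (-1), pj τ b 1, pj τ b (-1), diagonal k, diagonal k], ?_, ?_, ?_⟩
  · intro x
    fin_cases x
    · exact pj_symm σ a 1 hσ ha
    · exact pj_symm σ a (-1) hσ ha
    · exact pj_symm τ b 1 hτ hb
    · exact pj_symm τ b (-1) hτ hb
    · exact diagonal_transpose k
    · exact diagonal_transpose k
  · intro x
    fin_cases x
    · exact pj_idem σ a 1 (by norm_num) hσ ha ha1
    · exact pj_idem σ a (-1) (by norm_num) hσ ha ha1
    · exact pj_idem τ b 1 (by norm_num) hτ hb hb1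
    · exact pj_idem τ b (-1) (by norm_num) hτ hb hb1
    · exact hd
    · exact hd
  · have : ∑ x, (![pj σ a 1, pj σ a (-1), pj τ b 1, pj τ b (-1), diagonal k, diagonal k] :
        Fin 6 → Matrix (Fin (n+1)) (Fin (n+1)) ℝ) x =
        pj σ a 1 + pj σ a (-1) + pj τ b 1 + pj τ b (-1) + diagonal k + diagonal k := by
      rw [Fin.sum_univ_six]; rfl
    rw [this]
    ext i j
    by_cases h : i = j
    · subst h
      simp only [pj, Matrix.add_apply, of_apply, diagonal_apply_eq, Matrix.smul_apply, one_apply_eq, if_true]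
      rw [← hs i]
      split_ifs <;> simp <;> ring
    · have h' : ¬ j = i := fun e => h e.symm
      simp only [pj, Matrix.add_apply, of_apply, diagonal_apply_ne _ h, Matrix.smul_apply, one_apply_ne h, if_neg h']
      split_ifs <;> simp

lemma proj_trace_bound {d : ℕ} (E F : Matrix (Fin d) (Fin d) ℝ) (hE : Eᵀ = E) (hE2 : E * E = E)
    (hF : Fᵀ = F) (hF2 : F * F = F) : |(E * F).trace| ≤ d := by
  have key : ∀ (E : Matrix (Fin d) (Fin d) ℝ), Eᵀ = E → E * E = E → ∀ i, ∑ j, E i j ^ 2 ≤ 1 := by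
    intro E hE hE2 i
    have h1 : ∑ j, E i j ^ 2 = E i i := by
      conv_rhs => rw [← hE2, Matrix.mul_apply]
      refine Finset.sum_congr rfl fun j _ => ?_
      have : E j i = E i j := by conv_lhs => rw [← hE, transpose_apply]
      rw [this, sq]
    have h2 : E i i ^ 2 ≤ ∑ j, E i j ^ 2 :=
      Finset.single_le_sum (f := fun j => E i j ^ 2) (fun j _ => sq_nonneg _) (Finset.mem_univ i)
    nlinarith
  have h3 : (E * F).trace = ∑ i, ∑ j, E i j * F i j := by
    rw [Matrix.trace]
    refine Finset.sum_congr rfl fun i _ => ?_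
    rw [diag_apply, Matrix.mul_apply]
    refine Finset.sum_congr rfl fun j _ => ?_
    have : F j i = F i j := by conv_lhs => rw [← hF, transpose_apply]
    rw [this]
  rw [h3]
  calc |∑ i, ∑ j, E i j * F i j| ≤ ∑ i : Fin d, |∑ j, E i j * F i j| := Finset.abs_sum_le_sum_abs _ _
    _ ≤ ∑ i : Fin d, (1 : ℝ) := by
        refine Finset.sum_le_sum fun i _ => ?_
        calc |∑ j, E i j * F i j| ≤ ∑ j, |E i j * F i j| := Finset.abs_sum_le_sum_abs _ _
          _ ≤ ∑ j, (E i j ^ 2 + F i j ^ 2) / 2 := by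
              refine Finset.sum_le_sum fun j _ => ?_
              rw [abs_le]; constructor <;> nlinarith [sq_nonneg (E i j + F i j), sq_nonneg (E i j - F i j)]
          _ = (∑ j, E i j ^ 2 + ∑ j, F i j ^ 2) / 2 := by
              rw [← Finset.sum_div, Finset.sum_add_distrib]
          _ ≤ 1 := by linarith [key E hE hE2 i, key F hF hF2 i]
    _ = d := by simp

lemma mkcorr {n : ℕ} (t : ℝ) (P : Fin 6 → Matrix (Fin (n+1)) (Fin (n+1)) ℝ)
    (hP : ∀ x, (P x)ᵀ = P x) (hP2 : ∀ x, P x * P x = P x)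
    (hs : ∑ x, P x = t • (1 : Matrix _ _ ℝ)) :
    ∃ p ∈ QCorr (Fin 6) (Fin 2), (∀ x y a b, |p x y a b| ≤ 1) ∧ Synchronous p ∧
      ∑ x, p x x 0 0 = t ∧ ∑ x, ∑ y, p x y 0 0 = t ^ 2 := by
  let E : Fin 6 → Fin 2 → Matrix (Fin (n+1)) (Fin (n+1)) ℝ :=
    fun x a => if a = 0 then P x else 1 - P x
  have hE0 : ∀ x, E x 0 = P x := fun x => rfl
  have hE1 : ∀ x, E x 1 = 1 - P x := fun x => rfl
  have hE : ∀ x a, (E x a)ᵀ = E x a := by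
    intro x a
    fin_cases a
    · exact hP x
    · show (1 - P x)ᵀ = 1 - P x
      rw [transpose_sub, hP, transpose_one]
  have hE2 : ∀ x a, E x a * E x a = E x a := by
    intro x a
    fin_cases a
    · exact hP2 x
    · show (1 - P x) * (1 - P x) = 1 - P x
      rw [sub_mul, one_mul, mul_sub, hP2, mul_one, sub_self, sub_zero]
  have hEs : ∀ x, ∑ a, E x a = 1 := by
    intro x; rw [Fin.sum_univ_two, hE0, hE1]; abel
  have hd : (0:ℝ) < ((n+1 : ℕ) : ℝ) := by positivity
  let p : Fin 6 → Fin 6 → Fin 2 → Fin 2 → ℝ :=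
    fun x y a b => (((n+1 : ℕ) : ℝ))⁻¹ * (E x a * E y b).trace
  have htr : (1 : Matrix (Fin (n+1)) (Fin (n+1)) ℝ).trace = ((n+1 : ℕ) : ℝ) := by
    rw [trace_one, Fintype.card_fin]
  refine ⟨p, ?_, ?_, ?_, ?_, ?_⟩
  · let φ : Matrix (Fin (n+1)) (Fin (n+1)) ℝ →+* Matrix (Fin (n+1)) (Fin (n+1)) ℂ :=
      Complex.ofRealHom.mapMatrix
    have hφT : ∀ A, (φ A)ᵀ = φ Aᵀ := fun A => rfl
    have hφH : ∀ A, (φ A)ᴴ = φ Aᵀ := by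
      intro A; ext i j; simp [φ]
    have hφt : ∀ A, (φ A).trace = (A.trace : ℂ) := by
      intro A; simp [φ, Matrix.trace]
    let X : Matrix (Fin (n+1)) (Fin (n+1)) ℝ := (√((n+1 : ℕ) : ℝ))⁻¹ • 1
    have hXX : ∀ A : Matrix (Fin (n+1)) (Fin (n+1)) ℝ,
        (Xᵀ * (A * X)) = (((n+1 : ℕ) : ℝ))⁻¹ • A := by
      intro A
      simp only [X, transpose_smul, transpose_one, Matrix.smul_mul, Matrix.one_mul,
        Matrix.mul_smul, Matrix.mul_one, smul_smul]
      rw [← mul_inv, Real.mul_self_sqrt hd.le]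
    refine ⟨n+1, n+1, Nat.succ_pos _, Nat.succ_pos _, fun x a => φ (E x a), fun x a => φ (E x a),
      vec (φ X), ?_, ?_, ?_, ?_, ?_, ?_⟩
    · intro x a
      refine ⟨by rw [IsHermitian, hφH, hE], by rw [← map_mul, hE2]⟩
    · intro x; rw [← map_sum, hEs, map_one]
    · intro x a
      refine ⟨by rw [IsHermitian, hφH, hE], by rw [← map_mul, hE2]⟩
    · intro x; rw [← map_sum, hEs, map_one]
    · rw [star_vec_dotProduct_vec, hφH, ← map_mul, hφt]
      have := hXX 1
      rw [one_mul] at this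
      rw [this, trace_smul, htr, smul_eq_mul, inv_mul_cancel₀ hd.ne', Complex.ofReal_one]
    · intro x y a b
      have := kronecker_mulVec_vec (φ (E y b)) (φ X) (φ (E x a))
      rw [this, star_vec_dotProduct_vec, hφH, hφT, hE, ← map_mul, ← map_mul, ← map_mul, hφt,
        ← mul_assoc, hXX, smul_mul, trace_smul, trace_mul_comm, smul_eq_mul]
  · intro x y a b
    have := proj_trace_bound (E x a) (E y b) (hE x a) (hE2 x a) (hE y b) (hE2 y b)
    simp only [p]
    rw [abs_mul, abs_of_pos (inv_pos.2 hd), inv_mul_le_iff₀ hd, mul_one]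
    exact this
  · intro x a b hab
    have h0 : P x * (1 - P x) = 0 := by rw [mul_sub, hP2, mul_one, sub_self]
    have h1 : (1 - P x) * P x = 0 := by rw [sub_mul, hP2, one_mul, sub_self]
    simp only [p]
    have : E x a * E x b = 0 := by
      fin_cases a <;> fin_cases b
      · exact absurd rfl hab
      · exact h0
      · exact h1
      · exact absurd rfl hab
    rw [this, trace_zero, mul_zero]
  · simp only [p, hE0, hP2]
    rw [← Finset.mul_sum, ← trace_sum, hs, trace_smul, htr, smul_eq_mul]
    field_simp
  · simp only [p, hE0]
    simp_rw [← Finset.mul_sum, ← trace_sum, ← Finset.mul_sum, ← Finset.sum_mul, hs]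
    rw [smul_mul, one_mul, smul_smul, trace_smul, htr, smul_eq_mul]
    field_simp

lemma idem_trace {V : Type*} [AddCommGroup V] [Module ℂ V] [FiniteDimensional ℂ V]
    (f : V →ₗ[ℂ] V) (h : IsIdempotentElem f) :
    LinearMap.trace ℂ V f = (Module.finrank ℂ (LinearMap.range f) : ℂ) :=
  ((LinearMap.isProj_range_iff_isIdempotentElem _).2 h).trace

lemma rational_of {N dA dB : ℕ} (t : ℝ) (X : Matrix (Fin dB) (Fin dA) ℂ) (hX : X ≠ 0)
    (F : Fin N → Matrix (Fin dB) (Fin dB) ℂ) (G : Fin N → Matrix (Fin dA) (Fin dA) ℂ)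
    (hF : ∀ x, F x * F x = F x) (hFG : ∀ x, F x * X = X * G x)
    (hS : (∑ x, F x) * X = (t : ℂ) • X) : ¬ Irrational t := by
  let R := LinearMap.range X.mulVecLin
  have hmaps : ∀ x, ∀ v ∈ R, (F x).mulVecLin v ∈ R := by
    rintro x _ ⟨w, rfl⟩
    refine ⟨(G x).mulVecLin w, ?_⟩
    simp only [mulVecLin_apply, mulVec_mulVec, hFG]
  let f : Fin N → (R →ₗ[ℂ] R) := fun x => (F x).mulVecLin.restrict (hmaps x)
  have hidem : ∀ x, IsIdempotentElem (f x) := by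
    intro x
    ext1 v
    apply Subtype.ext
    simp [f, LinearMap.restrict_apply, hF]
  have htrx : ∀ x, LinearMap.trace ℂ R (f x) = (Module.finrank ℂ (LinearMap.range (f x)) : ℂ) :=
    fun x => idem_trace (f x) (hidem x)
  have hsum : ∑ x, f x = (t : ℂ) • (1 : R →ₗ[ℂ] R) := by
    ext1 ⟨v, hv⟩
    apply Subtype.ext
    obtain ⟨w, rfl⟩ := hv
    have : (∑ x, F x) *ᵥ (X *ᵥ w) = (t : ℂ) • (X *ᵥ w) := by
      rw [mulVec_mulVec, hS, smul_mulVec]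
    rw [sum_mulVec] at this
    simpa [f, LinearMap.restrict_apply] using this
  have h1 := congrArg (LinearMap.trace ℂ R) hsum
  rw [map_sum, map_smul, LinearMap.trace_one, smul_eq_mul] at h1
  simp only [htrx] at h1
  have hR : Module.finrank ℂ R ≠ 0 := by
    intro h0
    rw [Submodule.finrank_eq_zero] at h0
    apply hX
    have h2 : X.mulVecLin = 0 := LinearMap.range_eq_bot.1 h0
    ext i j
    have h3 := congrFun (congrArg (fun g => g (Pi.single j 1)) h2) i
    simpa using h3
  have h4 : ((∑ x, Module.finrank ℂ (LinearMap.range (f x)) : ℕ) : ℝ) =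
      t * (Module.finrank ℂ R : ℝ) := by
    exact_mod_cast h1
  have h5 : (Module.finrank ℂ R : ℝ) ≠ 0 := by exact_mod_cast hR
  intro hirr
  apply hirr
  refine ⟨((∑ x, Module.finrank ℂ (LinearMap.range (f x)) : ℕ) : ℚ) / (Module.finrank ℂ R : ℚ), ?_⟩
  rw [Rat.cast_div, Rat.cast_natCast, Rat.cast_natCast, h4]
  field_simp

open scoped ComplexOrder in
lemma not_irr_of_mem (t : ℝ) (p : Fin 6 → Fin 6 → Fin 2 → Fin 2 → ℝ)
    (hp : p ∈ QCorr (Fin 6) (Fin 2)) (hsync : Synchronous p)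
    (h1 : ∑ x, p x x 0 0 = t) (h2 : ∑ x, ∑ y, p x y 0 0 = t ^ 2) : ¬ Irrational t := by
  obtain ⟨dA, dB, -, -, E, F, ψ, hE, hEs, hF, hFs, hψ, hpv⟩ := hp
  obtain ⟨X, rfl⟩ := vec_bijective.2 ψ
  have hpv' : ∀ x y a b, (p x y a b : ℂ) = (Xᴴ * (F y b * X * (E x a)ᵀ)).trace := by
    intro x y a b
    rw [hpv, ← star_vec_dotProduct_vec, ← kronecker_mulVec_vec]
  rw [star_vec_dotProduct_vec] at hψ
  have hX : X ≠ 0 := by rintro rfl; simp at hψ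
  have hF1 : ∀ x, F x 1 = 1 - F x 0 := by
    intro x; rw [← hFs x, Fin.sum_univ_two]; abel
  have hE1 : ∀ x, (E x 1)ᵀ = 1 - (E x 0)ᵀ := by
    intro x; rw [← transpose_one, ← hEs x, Fin.sum_univ_two, transpose_add]; abel
  -- a vanishing correlation gives a vanishing operator
  have hvan : ∀ x a b, a ≠ b → F x b * X * (E x a)ᵀ = 0 := by
    intro x a b hab
    have h0 := hpv' x x a b
    rw [hsync x a b hab, Complex.ofReal_zero] at h0
    rw [← trace_conjTranspose_mul_self_eq_zero_iff, h0]
    have hEH : ((E x a)ᵀ)ᴴ = (E x a)ᵀ := by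
      exact (hE x a).1.transpose.eq
    have hEE : (E x a)ᵀ * (E x a)ᵀ = (E x a)ᵀ := by rw [← transpose_mul, (hE x a).2]
    rw [conjTranspose_mul, conjTranspose_mul, hEH, (hF x b).1, Matrix.trace_mul_comm]
    have : F x b * X * (E x a)ᵀ * ((E x a)ᵀ * (Xᴴ * F x b)) =
      F x b * (X * ((E x a)ᵀ * (E x a)ᵀ) * Xᴴ * F x b) := by simp only [Matrix.mul_assoc]
    rw [this, hEE, Matrix.trace_mul_comm]
    have : X * (E x a)ᵀ * Xᴴ * F x b * F x b = X * (E x a)ᵀ * (Xᴴ * (F x b * F x b)) := by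
      simp only [Matrix.mul_assoc]
    rw [this, (hF x b).2, Matrix.trace_mul_comm]
    have : Xᴴ * F x b * (X * (E x a)ᵀ) = Xᴴ * (F x b * X * (E x a)ᵀ) := by
      simp only [Matrix.mul_assoc]
    rw [this]
  have hFG : ∀ x, F x 0 * X = X * (E x 0)ᵀ := by
    intro x
    have ha := hvan x 1 0 (by decide)
    have hb := hvan x 0 1 (by decide)
    rw [hE1, Matrix.mul_sub, Matrix.mul_one, sub_eq_zero] at ha
    rw [hF1, Matrix.sub_mul, Matrix.sub_mul, Matrix.one_mul, sub_eq_zero] at hb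
    rw [ha, hb]
  set S := ∑ x, F x 0 with hSdef
  have hSH : Sᴴ = S := by
    rw [hSdef, conjTranspose_sum]; exact Finset.sum_congr rfl fun x _ => (hF x 0).1
  have hc1 : (Xᴴ * (S * X)).trace = t := by
    rw [← h1, Complex.ofReal_sum, hSdef, Matrix.sum_mul, Matrix.mul_sum, trace_sum]
    refine Finset.sum_congr rfl fun x _ => ?_
    rw [hpv', Matrix.mul_assoc (F x 0), ← hFG, ← Matrix.mul_assoc (F x 0), (hF x 0).2]
  have hc2 : (Xᴴ * (S * (S * X))).trace = t ^ 2 := by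
    rw [← Complex.ofReal_pow, ← h2]
    simp only [Complex.ofReal_sum, hpv', Matrix.mul_assoc, ← hFG]
    simp only [← trace_sum, ← Matrix.mul_sum, ← Matrix.sum_mul]
    rw [hSdef]
  refine rational_of t X hX (fun x => F x 0) (fun x => (E x 0)ᵀ) (fun x => (hF x 0).2) hFG ?_
  rw [← sub_eq_zero, ← trace_conjTranspose_mul_self_eq_zero_iff]
  show ((S * X - (t : ℂ) • X)ᴴ * (S * X - (t : ℂ) • X)).trace = 0
  rw [conjTranspose_sub, conjTranspose_mul, conjTranspose_smul, hSH, Complex.star_def,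
    Complex.conj_ofReal]
  simp only [Matrix.sub_mul, Matrix.mul_sub, Matrix.smul_mul, Matrix.mul_smul, trace_sub,
    trace_smul, Matrix.mul_assoc, hc1, hc2, hψ, smul_eq_mul]
  ring

lemma sync_closed (I O : Type) : IsClosed {p : I → I → O → O → ℝ | Synchronous p} := by
  simp only [Synchronous, Set.ofPred_forall]
  refine isClosed_iInter fun x => isClosed_iInter fun a => isClosed_iInter fun b =>
    isClosed_iInter fun _ => ?_
  exact isClosed_eq (by fun_prop) continuous_const

lemma not_closed : ¬ IsClosed (QCorr (Fin 6) (Fin 2)) := by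
  intro hcl
  obtain ⟨s, hirr, hs0, hs1⟩ := exists_irrational_btwn (show (0:ℝ) < 1 by norm_num)
  let L : (Fin 6 → Fin 6 → Fin 2 → Fin 2 → ℝ) → ℝ := fun p => ∑ x, p x x 0 0
  have hL : Continuous L := by fun_prop
  let K : Set (Fin 6 → Fin 6 → Fin 2 → Fin 2 → ℝ) :=
    (Set.univ.pi fun _ => Set.univ.pi fun _ => Set.univ.pi fun _ => Set.univ.pi fun _ =>
      Set.Icc (-1) 1) ∩
    (QCorr (Fin 6) (Fin 2) ∩ ({p | Synchronous p} ∩ {p | ∑ x, ∑ y, p x y 0 0 = L p ^ 2}))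
  have hK : IsCompact K := by
    refine IsCompact.inter_right ?_ (hcl.inter ((sync_closed _ _).inter
      (isClosed_eq (by fun_prop) (by fun_prop))))
    exact isCompact_univ_pi fun _ => isCompact_univ_pi fun _ => isCompact_univ_pi fun _ =>
      isCompact_univ_pi fun _ => isCompact_Icc
  have hcl' : IsClosed (L '' K) := (hK.image hL).isClosed
  have hlim : Filter.Tendsto (fun n : ℕ => 2 + 2 * ((⌊s * ((n + 1 : ℕ) : ℝ)⌋₊ : ℝ) / ((n + 1 : ℕ) : ℝ)))
      Filter.atTop (nhds (2 + 2 * s)) := by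
    have h := (tendsto_nat_floor_mul_div_atTop hs0.le).comp
      ((tendsto_natCast_atTop_atTop (R := ℝ)).comp (Filter.tendsto_add_atTop_nat 1))
    exact (h.const_mul 2).const_add 2
  have hmem : 2 + 2 * s ∈ L '' K := by
    refine hcl'.mem_of_tendsto hlim (Filter.Eventually.of_forall fun n => ?_)
    have hc : ⌊s * ((n + 1 : ℕ) : ℝ)⌋₊ < n + 1 := by
      have hd : (0:ℝ) < ((n+1 : ℕ) : ℝ) := by positivity
      rw [Nat.floor_lt (by positivity)]
      nlinarith
    obtain ⟨P, hP, hP2, hPs⟩ := projs n _ hc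
    obtain ⟨p, hp, hb, hsy, h1, h2⟩ := mkcorr _ P hP hP2 hPs
    refine ⟨p, ⟨?_, hp, hsy, ?_⟩, h1⟩
    · intro x _ y _ a _ b _
      exact abs_le.1 (hb x y a b)
    · show _ = L p ^ 2
      rw [h2, ← h1]
  obtain ⟨p, ⟨-, hp, hsy, h2⟩, h1⟩ := hmem
  refine not_irr_of_mem (2 + 2 * s) p hp hsy h1 (by rw [← h1]; exact h2) ?_
  have := (hirr.natCast_mul (m := 2) (by norm_num)).natCast_add 2
  exact_mod_cast this

/-- If `C_q(n,m)` is closed then so is its synchronous part; consequently, since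
`C_q^s(m,2^n)` fails to be closed for suitable `m, n`, the set `C_q(m, 2^n)` is
not closed for some `m, n ≥ 1`. -/
theorem qCorr_closed_implies_sync_closed_and_exists_qCorr_not_closed :
    (∀ n m : ℕ, 1 ≤ n → 1 ≤ m → IsClosed (QCorr (Fin n) (Fin m)) →
      IsClosed {p ∈ QCorr (Fin n) (Fin m) | Synchronous p}) ∧
    (∃ m n : ℕ, 1 ≤ m ∧ 1 ≤ n ∧
      ¬ IsClosed (QCorr (Fin m) (Fin (2 ^ n)))) := by
  refine ⟨fun n m _ _ h => h.inter (sync_closed _ _), 6, 1, by norm_num, by norm_num, ?_⟩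
  exact not_closed
end
end
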